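/- Locking-free second-order convergence of the MAC-E displacements: there exist constants C > 0 and h₀ > 0, depending only on μ and the mesh-regularity constant C₀ (in particular independent of h, l and of the Lamé constant λ), such that if max(h, l) ≤ h₀ and (W^x, W^y, Z^{11}, Z^{22}, Z^{12}) solves the MAC-E scheme with data f¹, f² computed from the exact solution, then ‖W^x − u^x‖_{TM} ≤ C(h²+l²)(‖u‖_{3,∞} + ‖σ‖_{3,∞}) and ‖W^y − u^y‖_{MT} ≤ C(h²+l²)(‖u‖_{3,∞} + ‖σ‖_{3,∞}), where u^x, u^y are evaluated pointwise at the corresponding staggered grid points. -/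

import Mathlib

open Finset

noncomputable section

/-- The midpoint `x_{i+1/2} = (x_i + x_{i+1})/2`. -/
def midpt (x : ℕ → ℝ) (i : ℕ) : ℝ := (x i + x (i + 1)) / 2

/-- The cell width `h_{i+1/2} = x_{i+1} - x_i`. -/
def hMid (x : ℕ → ℝ) (i : ℕ) : ℝ := x (i + 1) - x i

/-- `h_i = x_{i+1/2} - x_{i-1/2}` for `1 ≤ i ≤ n-1`, together with the boundary
conventions `h_0 = h_{1/2}/2` and `h_n = h_{n-1/2}/2`. -/
def hNode (x : ℕ → ℝ) (n i : ℕ) : ℝ :=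
  if i = 0 then hMid x 0 / 2
  else if i = n then hMid x (n - 1) / 2
  else midpt x i - midpt x (i - 1)

/-- `0 = x_0 < x_1 < ⋯ < x_n = 1`. -/
def IsGrid (x : ℕ → ℝ) (n : ℕ) : Prop :=
  x 0 = 0 ∧ x n = 1 ∧ ∀ i < n, x i < x (i + 1)

/-- Discrete inner product `(φ,θ)_M` over the cell centers `(x_{i+1/2}, y_{j+1/2})`. -/
def ipM (x y : ℕ → ℝ) (nx ny : ℕ) (φ θ : ℕ → ℕ → ℝ) : ℝ :=
  ∑ i ∈ range nx, ∑ j ∈ range ny, hMid x i * hMid y j * φ i j * θ i j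

/-- Discrete inner product `(φ,θ)_T` over the grid nodes `(x_i, y_j)`. -/
def ipT (x y : ℕ → ℝ) (nx ny : ℕ) (φ θ : ℕ → ℕ → ℝ) : ℝ :=
  ∑ i ∈ range (nx + 1), ∑ j ∈ range (ny + 1), hNode x nx i * hNode y ny j * φ i j * θ i j

/-- Discrete inner product `(φ,θ)_{TM}` over the points `(x_i, y_{j+1/2})`,
`1 ≤ i ≤ n_x - 1`, `0 ≤ j ≤ n_y - 1`. -/
def ipTM (x y : ℕ → ℝ) (nx ny : ℕ) (φ θ : ℕ → ℕ → ℝ) : ℝ :=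
  ∑ i ∈ Ico 1 nx, ∑ j ∈ range ny, hNode x nx i * hMid y j * φ i j * θ i j

/-- Discrete inner product `(φ,θ)_{MT}` over the points `(x_{i+1/2}, y_j)`,
`0 ≤ i ≤ n_x - 1`, `1 ≤ j ≤ n_y - 1`. -/
def ipMT (x y : ℕ → ℝ) (nx ny : ℕ) (φ θ : ℕ → ℕ → ℝ) : ℝ :=
  ∑ i ∈ range nx, ∑ j ∈ Ico 1 ny, hMid x i * hNode y ny j * φ i j * θ i j

/-- `D_y` of an edge function `v` given at `(x-index, y_{j+1/2})` with extra boundary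
rows `v0` (at `y_0`) and `vn` (at `y_{n_y}`); the result is a node function. -/
def DyE (y : ℕ → ℝ) (ny : ℕ) (v : ℕ → ℕ → ℝ) (v0 vn : ℕ → ℝ) (i j : ℕ) : ℝ :=
  if j = 0 then (v i 0 - v0 i) / hNode y ny 0
  else if j = ny then (vn i - v i (ny - 1)) / hNode y ny ny
  else (v i j - v i (j - 1)) / hNode y ny j

/-- `D_x` of an edge function `v` given at `(x_{i+1/2}, y-index)` with extra boundary
columns `v0` (at `x_0`) and `vn` (at `x_{n_x}`); the result is a node function. -/
def DxE (x : ℕ → ℝ) (nx : ℕ) (v : ℕ → ℕ → ℝ) (v0 vn : ℕ → ℝ) (i j : ℕ) : ℝ :=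
  if i = 0 then (v 0 j - v0 j) / hNode x nx 0
  else if i = nx then (vn j - v (nx - 1) j) / hNode x nx nx
  else (v i j - v (i - 1) j) / hNode x nx i

/-- The MAC-E scheme on the staggered grid: `(Wx, Wy, Z11, Z22, Z12)` (with the extra
boundary rows/columns `Wx0, Wxn` of `Wx` at `y = y_0, y_{n_y}` and `Wy0, Wyn` of `Wy`
at `x = x_0, x_{n_x}`) solves the scheme with data `f1, f2`. -/
def MACESol (nx ny : ℕ) (x y : ℕ → ℝ) (lam mu : ℝ)
    (Wx : ℕ → ℕ → ℝ) (Wx0 Wxn : ℕ → ℝ)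
    (Wy : ℕ → ℕ → ℝ) (Wy0 Wyn : ℕ → ℝ)
    (Z11 Z22 Z12 f1 f2 : ℕ → ℕ → ℝ) : Prop :=
  -- boundary conditions for the displacements
  (∀ j < ny, Wx 0 j = 0 ∧ Wx nx j = 0) ∧
  (∀ i ≤ nx, Wx0 i = 0 ∧ Wxn i = 0) ∧
  (∀ i < nx, Wy i 0 = 0 ∧ Wy i ny = 0) ∧
  (∀ j ≤ ny, Wy0 j = 0 ∧ Wyn j = 0) ∧
  -- constitutive equations at the cell centers
  (∀ i < nx, ∀ j < ny,
    (1 / (2 * mu)) * (Z11 i j - lam / (2 * lam + 2 * mu) * (Z11 i j + Z22 i j))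
      = (Wx (i + 1) j - Wx i j) / hMid x i) ∧
  (∀ i < nx, ∀ j < ny,
    (1 / (2 * mu)) * (Z22 i j - lam / (2 * lam + 2 * mu) * (Z11 i j + Z22 i j))
      = (Wy i (j + 1) - Wy i j) / hMid y j) ∧
  -- shear stress equation at the grid nodes
  (∀ i ≤ nx, ∀ j ≤ ny,
    Z12 i j = mu * (DyE y ny Wx Wx0 Wxn i j + DxE x nx Wy Wy0 Wyn i j)) ∧
  -- momentum equations
  (∀ i, 1 ≤ i → i < nx → ∀ j < ny,
    (Z11 i j - Z11 (i - 1) j) / hNode x nx i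
      + (Z12 i (j + 1) - Z12 i j) / hMid y j = f1 i j) ∧
  (∀ i < nx, ∀ j, 1 ≤ j → j < ny →
    (Z12 (i + 1) j - Z12 i j) / hMid x i
      + (Z22 i j - Z22 i (j - 1)) / hNode y ny j = f2 i j)

/-- First partial derivative in `x`. -/
def pdx (f : ℝ × ℝ → ℝ) (p : ℝ × ℝ) : ℝ := deriv (fun t => f (t, p.2)) p.1

/-- First partial derivative in `y`. -/
def pdy (f : ℝ × ℝ → ℝ) (p : ℝ × ℝ) : ℝ := deriv (fun t => f (p.1, t)) p.2

/-- The norm `‖f‖_{3,∞}`: the sup over `[0,1]²` of the derivatives of `f` of order at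
most `3`. -/
def norm3 (f : ℝ × ℝ → ℝ) : ℝ :=
  ⨆ p : Set.Icc ((0 : ℝ), (0 : ℝ)) ((1 : ℝ), (1 : ℝ)), ⨆ k : Fin 4,
    ‖iteratedFDeriv ℝ (k : ℕ) f (p : ℝ × ℝ)‖

/-- The mesh size `h = max_i h_{i+1/2}`. -/
def hmax (x : ℕ → ℝ) (n : ℕ) : ℝ := ⨆ i : Fin n, hMid x i

/-- Mean value inequality along a segment of the real line. -/
lemma abs_sub_le_of_hasDerivAt {g g' : ℝ → ℝ} {a b C : ℝ}
    (hd : ∀ t ∈ Set.uIcc a b, HasDerivAt g (g' t) t)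
    (hb : ∀ t ∈ Set.uIcc a b, |g' t| ≤ C) : |g b - g a| ≤ C * |b - a| :=
  (convex_uIcc a b).norm_image_sub_le_of_norm_hasDerivWithin_le
    (fun t ht => (hd t ht).hasDerivWithinAt) hb Set.left_mem_uIcc Set.right_mem_uIcc

lemma abs_sub_left_le_of_mem_uIcc {a b t : ℝ} (ht : t ∈ Set.uIcc a b) :
    |t - a| ≤ |b - a| := by
  rw [abs_sub_comm t a, abs_sub_comm b a]
  exact Set.abs_sub_le_of_uIcc_subset_uIcc (Set.uIcc_subset_uIcc_left ht) |> fun h => by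
    simpa [abs_sub_comm] using h

lemma abs_taylor_one_le {v v₁ v₂ : ℝ → ℝ} {a b M : ℝ}
    (h₁ : ∀ t, HasDerivAt v (v₁ t) t) (h₂ : ∀ t, HasDerivAt v₁ (v₂ t) t)
    (hM : ∀ t ∈ Set.uIcc a b, |v₂ t| ≤ M) :
    |v b - v a - (b - a) * v₁ a| ≤ M * |b - a| ^ 2 := by
  have hM0 : 0 ≤ M := (abs_nonneg _).trans (hM a Set.left_mem_uIcc)
  have key := abs_sub_le_of_hasDerivAt (g := fun t => v t - (t - a) * v₁ a)
    (g' := fun t => v₁ t - v₁ a) (a := a) (b := b) (C := M * |b - a|)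
    (fun t _ => ((h₁ t).sub (((hasDerivAt_id t).sub_const a).mul_const (v₁ a))).congr_deriv
      (by simp))
    (fun t ht => (abs_sub_le_of_hasDerivAt (fun s _ => h₂ s)
      (fun s hs => hM s (Set.uIcc_subset_uIcc_left ht hs))).trans
        (mul_le_mul_of_nonneg_left (abs_sub_left_le_of_mem_uIcc ht) hM0))
  calc _ = |v b - (b - a) * v₁ a - (v a - (a - a) * v₁ a)| := by ring_nf
    _ ≤ _ := key
    _ = _ := by ring

lemma abs_taylor_two_le {v v₁ v₂ v₃ : ℝ → ℝ} {a b M : ℝ}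
    (h₁ : ∀ t, HasDerivAt v (v₁ t) t) (h₂ : ∀ t, HasDerivAt v₁ (v₂ t) t)
    (h₃ : ∀ t, HasDerivAt v₂ (v₃ t) t) (hM : ∀ t ∈ Set.uIcc a b, |v₃ t| ≤ M) :
    |v b - v a - (b - a) * v₁ a - (b - a) ^ 2 / 2 * v₂ a| ≤ M * |b - a| ^ 3 := by
  have hM0 : 0 ≤ M := (abs_nonneg _).trans (hM a Set.left_mem_uIcc)
  have key := abs_sub_le_of_hasDerivAt
    (g := fun t => v t - (t - a) * v₁ a - (t - a) ^ 2 / 2 * v₂ a)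
    (g' := fun t => v₁ t - v₁ a - (t - a) * v₂ a) (a := a) (b := b) (C := M * |b - a| ^ 2)
    (fun t _ => by
      have h := ((h₁ t).sub (((hasDerivAt_id t).sub_const a).mul_const (v₁ a))).sub
        (((((hasDerivAt_id t).sub_const a).pow 2).div_const 2).mul_const (v₂ a))
      exact h.congr_deriv (by simp))
    (fun t ht => (abs_taylor_one_le h₂ h₃
      (fun s hs => hM s (Set.uIcc_subset_uIcc_left ht hs))).trans (by
        have := abs_sub_left_le_of_mem_uIcc ht
        gcongr))
  calc _ = |v b - (b - a) * v₁ a - (b - a) ^ 2 / 2 * v₂ a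
        - (v a - (a - a) * v₁ a - (a - a) ^ 2 / 2 * v₂ a)| := by ring_nf
    _ ≤ _ := key
    _ = _ := by ring

lemma abs_taylor_three_le {v v₁ v₂ v₃ v₄ : ℝ → ℝ} {a b M : ℝ}
    (h₁ : ∀ t, HasDerivAt v (v₁ t) t) (h₂ : ∀ t, HasDerivAt v₁ (v₂ t) t)
    (h₃ : ∀ t, HasDerivAt v₂ (v₃ t) t) (h₄ : ∀ t, HasDerivAt v₃ (v₄ t) t)
    (hM : ∀ t ∈ Set.uIcc a b, |v₄ t| ≤ M) :
    |v b - v a - (b - a) * v₁ a - (b - a) ^ 2 / 2 * v₂ a - (b - a) ^ 3 / 6 * v₃ a|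
      ≤ M * |b - a| ^ 4 := by
  have hM0 : 0 ≤ M := (abs_nonneg _).trans (hM a Set.left_mem_uIcc)
  have key := abs_sub_le_of_hasDerivAt
    (g := fun t => v t - (t - a) * v₁ a - (t - a) ^ 2 / 2 * v₂ a - (t - a) ^ 3 / 6 * v₃ a)
    (g' := fun t => v₁ t - v₁ a - (t - a) * v₂ a - (t - a) ^ 2 / 2 * v₃ a)
    (a := a) (b := b) (C := M * |b - a| ^ 3)
    (fun t _ => by
      have h := (((h₁ t).sub (((hasDerivAt_id t).sub_const a).mul_const (v₁ a))).sub
        (((((hasDerivAt_id t).sub_const a).pow 2).div_const 2).mul_const (v₂ a))).sub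
        (((((hasDerivAt_id t).sub_const a).pow 3).div_const 6).mul_const (v₃ a))
      exact h.congr_deriv (by push_cast; simp only [id]; ring))
    (fun t ht => (abs_taylor_two_le h₂ h₃ h₄
      (fun s hs => hM s (Set.uIcc_subset_uIcc_left ht hs))).trans (by
        have := abs_sub_left_le_of_mem_uIcc ht
        gcongr))
  calc _ = |v b - (b - a) * v₁ a - (b - a) ^ 2 / 2 * v₂ a - (b - a) ^ 3 / 6 * v₃ a
        - (v a - (a - a) * v₁ a - (a - a) ^ 2 / 2 * v₂ a - (a - a) ^ 3 / 6 * v₃ a)| := by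
          ring_nf
    _ ≤ _ := key
    _ = _ := by ring

/-- Error of the difference quotient centred at the midpoint of an interval. -/
lemma abs_midpoint_difference_le {v v₁ v₂ v₃ : ℝ → ℝ} {a b M : ℝ} (hab : a ≤ b)
    (h₁ : ∀ t, HasDerivAt v (v₁ t) t) (h₂ : ∀ t, HasDerivAt v₁ (v₂ t) t)
    (h₃ : ∀ t, HasDerivAt v₂ (v₃ t) t) (hM : ∀ t ∈ Set.Icc a b, |v₃ t| ≤ M) :
    |v b - v a - (b - a) * v₁ ((a + b) / 2)| ≤ M * (b - a) ^ 3 := by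
  have hM0 : 0 ≤ M := (abs_nonneg _).trans (hM a ⟨le_rfl, hab⟩)
  have hr := abs_taylor_two_le (a := (a + b) / 2) (b := b) h₁ h₂ h₃ (M := M) (fun t ht => hM t (by
    rw [Set.uIcc_of_le (by linarith)] at ht; exact ⟨by linarith [ht.1], ht.2⟩))
  have hl := abs_taylor_two_le (a := (a + b) / 2) (b := a) h₁ h₂ h₃ (M := M) (fun t ht => hM t (by
    rw [Set.uIcc_of_ge (by linarith)] at ht; exact ⟨ht.1, by linarith [ht.2]⟩))
  rw [show b - (a + b) / 2 = (b - a) / 2 by ring, abs_of_nonneg (a := (b - a) / 2) (by linarith)]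
    at hr
  rw [show a - (a + b) / 2 = -((b - a) / 2) by ring, abs_neg,
    abs_of_nonneg (a := (b - a) / 2) (by linarith)] at hl
  have h3 : 0 ≤ M * (b - a) ^ 3 := mul_nonneg hM0 (pow_nonneg (by linarith) 3)
  rw [abs_le] at *
  constructor <;> nlinarith

/-- Expansion of the mean value of `v₁` over an interval around its midpoint. -/
lemma abs_mean_expansion_le {v v₁ v₂ v₃ v₄ : ℝ → ℝ} {a b M : ℝ} (hab : a ≤ b)
    (h₁ : ∀ t, HasDerivAt v (v₁ t) t) (h₂ : ∀ t, HasDerivAt v₁ (v₂ t) t)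
    (h₃ : ∀ t, HasDerivAt v₂ (v₃ t) t) (h₄ : ∀ t, HasDerivAt v₃ (v₄ t) t)
    (hM : ∀ t ∈ Set.Icc a b, |v₄ t| ≤ M) :
    |v b - v a - (b - a) * v₁ ((a + b) / 2) - (b - a) ^ 3 / 24 * v₃ ((a + b) / 2)|
      ≤ M * (b - a) ^ 4 := by
  have hM0 : 0 ≤ M := (abs_nonneg _).trans (hM a ⟨le_rfl, hab⟩)
  have hr := abs_taylor_three_le (a := (a + b) / 2) (b := b) h₁ h₂ h₃ h₄ (M := M)
    (fun t ht => hM t (by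
    rw [Set.uIcc_of_le (by linarith)] at ht; exact ⟨by linarith [ht.1], ht.2⟩))
  have hl := abs_taylor_three_le (a := (a + b) / 2) (b := a) h₁ h₂ h₃ h₄ (M := M)
    (fun t ht => hM t (by
    rw [Set.uIcc_of_ge (by linarith)] at ht; exact ⟨ht.1, by linarith [ht.2]⟩))
  rw [show b - (a + b) / 2 = (b - a) / 2 by ring, abs_of_nonneg (a := (b - a) / 2) (by linarith)]
    at hr
  rw [show a - (a + b) / 2 = -((b - a) / 2) by ring, abs_neg,
    abs_of_nonneg (a := (b - a) / 2) (by linarith)] at hl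
  have h3 : 0 ≤ M * (b - a) ^ 4 := mul_nonneg hM0 (pow_nonneg (by linarith) 4)
  rw [abs_le] at *
  constructor <;> nlinarith

/-- One-sided expansion with the quadratic term evaluated at the far end point. -/
lemma abs_corrected_difference_le {v v₁ v₂ v₃ : ℝ → ℝ} {a b M : ℝ}
    (h₁ : ∀ t, HasDerivAt v (v₁ t) t) (h₂ : ∀ t, HasDerivAt v₁ (v₂ t) t)
    (h₃ : ∀ t, HasDerivAt v₂ (v₃ t) t) (hM : ∀ t ∈ Set.uIcc a b, |v₃ t| ≤ M) :
    |v b - (b - a) ^ 2 / 2 * v₂ b - v a - (b - a) * v₁ a| ≤ 2 * M * |b - a| ^ 3 := by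
  have hM0 : 0 ≤ M := (abs_nonneg _).trans (hM a Set.left_mem_uIcc)
  have h := abs_taylor_two_le h₁ h₂ h₃ hM
  have h' := abs_sub_le_of_hasDerivAt (fun t _ => h₃ t) hM
  have h3 : 0 ≤ M * |b - a| ^ 3 := by positivity
  calc |v b - (b - a) ^ 2 / 2 * v₂ b - v a - (b - a) * v₁ a|
      = |(v b - v a - (b - a) * v₁ a - (b - a) ^ 2 / 2 * v₂ a)
          - (b - a) ^ 2 / 2 * (v₂ b - v₂ a)| := by ring_nf
    _ ≤ |v b - v a - (b - a) * v₁ a - (b - a) ^ 2 / 2 * v₂ a|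
          + |(b - a) ^ 2 / 2 * (v₂ b - v₂ a)| := abs_sub _ _
    _ ≤ M * |b - a| ^ 3 + |b - a| ^ 2 / 2 * (M * |b - a|) := by
        rw [abs_mul, abs_of_nonneg (a := (b - a) ^ 2 / 2) (by positivity), sq_abs]
        gcongr
    _ ≤ _ := by nlinarith

section Grid

variable {x : ℕ → ℝ} {n : ℕ}

lemma IsGrid.mono (hx : IsGrid x n) {i j : ℕ} (hij : i ≤ j) (hj : j ≤ n) : x i ≤ x j := by
  induction j, hij using Nat.le_induction with
  | base => exact le_rfl
  | succ k _ ih => exact (ih (by omega)).trans (hx.2.2 k (by omega)).le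

lemma IsGrid.mem_Icc (hx : IsGrid x n) {i : ℕ} (hi : i ≤ n) : x i ∈ Set.Icc (0 : ℝ) 1 :=
  ⟨hx.1 ▸ hx.mono (Nat.zero_le i) hi, hx.2.1 ▸ hx.mono hi le_rfl⟩

lemma IsGrid.hMid_pos (hx : IsGrid x n) {i : ℕ} (hi : i < n) : 0 < hMid x i :=
  sub_pos.2 (hx.2.2 i hi)

lemma IsGrid.midpt_mem (hx : IsGrid x n) {i : ℕ} (hi : i < n) :
    midpt x i ∈ Set.Ioo (0 : ℝ) 1 := by
  have h0 := (hx.mem_Icc hi.le).1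
  have h1 := (hx.mem_Icc (Nat.succ_le_of_lt hi)).2
  have := hx.2.2 i hi
  constructor <;> unfold midpt <;> linarith

lemma IsGrid.sum_hMid (hx : IsGrid x n) : ∑ i ∈ range n, hMid x i = 1 := by
  unfold hMid
  rw [sum_range_sub, hx.1, hx.2.1, sub_zero]

lemma hNode_eq (hn : 1 ≤ n) (i : ℕ) (hi : i ≤ n) : hNode x n i =
    (if i < n then hMid x i / 2 else 0) + (if 0 < i then hMid x (i - 1) / 2 else 0) := by
  unfold hNode
  rcases Nat.eq_zero_or_pos i with rfl | hi0
  · simp [show 0 < n by omega]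
  · rcases hi.lt_or_eq with h | rfl
    · obtain ⟨k, rfl⟩ : ∃ k, i = k + 1 := ⟨i - 1, by omega⟩
      simp only [Nat.succ_ne_zero, if_false, h.ne, h, if_true, hi0, Nat.add_sub_cancel]
      unfold midpt hMid
      ring
    · simp [hi0.ne', hi0]

lemma IsGrid.hNode_pos (hx : IsGrid x n) (hn : 1 ≤ n) {i : ℕ} (hi : i ≤ n) :
    0 < hNode x n i := by
  rw [hNode_eq hn i hi]
  split_ifs with h1 h2 h2
  · linarith [hx.hMid_pos h1, hx.hMid_pos (i := i - 1) (by omega)]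
  · linarith [hx.hMid_pos h1]
  · linarith [hx.hMid_pos (i := i - 1) (by omega)]
  · omega

lemma IsGrid.sum_hNode (hx : IsGrid x n) (hn : 1 ≤ n) :
    ∑ i ∈ range (n + 1), hNode x n i = 1 := by
  have hs := hx.sum_hMid
  rw [sum_congr rfl fun i hi => hNode_eq hn i (Nat.lt_succ_iff.1 (mem_range.1 hi)),
    sum_add_distrib, sum_range_succ, sum_range_succ' (fun i => if 0 < i then _ else _)]
  simp only [lt_irrefl, if_false, add_zero, Nat.succ_pos, if_true, Nat.add_sub_cancel]
  rw [sum_congr rfl fun i hi => if_pos (mem_range.1 hi), ← sum_div, hs]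
  norm_num

lemma IsGrid.sum_hNode_interior_le (hx : IsGrid x n) (hn : 1 ≤ n) :
    ∑ i ∈ Ico 1 n, hNode x n i ≤ 1 := by
  rw [← hx.sum_hNode hn]
  refine sum_le_sum_of_subset_of_nonneg (fun i hi => ?_) fun i hi _ =>
    (hx.hNode_pos hn (Nat.lt_succ_iff.1 (mem_range.1 hi))).le
  rw [mem_Ico] at hi
  exact mem_range.2 (by omega)

/-- Summation by parts from cells to interior nodes. -/
lemma sum_Ico_by_parts (E e : ℕ → ℝ) (hn : 1 ≤ n) (h0 : e 0 = 0) (h1 : e n = 0) :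
    ∑ i ∈ Ico 1 n, (E i - E (i - 1)) * e i = -∑ i ∈ range n, E i * (e (i + 1) - e i) := by
  have key : ∀ m, ∑ i ∈ Ico 1 (m + 1), (E i - E (i - 1)) * e i
      = E m * e (m + 1) - E 0 * e 0 - ∑ i ∈ range (m + 1), E i * (e (i + 1) - e i) := by
    intro m
    induction m with
    | zero => simp; ring
    | succ m ih =>
      rw [sum_Ico_succ_top (by omega), ih, sum_range_succ _ (m + 1), Nat.add_sub_cancel]
      ring
  obtain ⟨m, rfl⟩ : ∃ m, n = m + 1 := ⟨n - 1, by omega⟩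
  rw [key, h0, h1]
  ring

lemma hNode_mul_DyE (hx : IsGrid x n) (hn : 1 ≤ n) (v : ℕ → ℕ → ℝ) (i j : ℕ) (hj : j ≤ n) :
    hNode x n j * DyE x n v (fun _ => 0) (fun _ => 0) i j
      = (if j < n then v i j else 0) - (if 0 < j then v i (j - 1) else 0) := by
  have hp := (hx.hNode_pos hn hj).ne'
  unfold DyE
  split_ifs with h1 h2 h3 h4 h5 h6 h7 <;> first | omega | skip
  all_goals try subst h1
  all_goals try rw [h5] at hp ⊢
  all_goals field_simp

/-- Summation by parts from nodes to cells, with vanishing boundary rows. -/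
lemma sum_range_by_parts (hx : IsGrid x n) (hn : 1 ≤ n) (F : ℕ → ℝ) (v : ℕ → ℕ → ℝ) (i : ℕ) :
    ∑ j ∈ range n, (F (j + 1) - F j) * v i j
      = -∑ j ∈ range (n + 1), hNode x n j * (F j * DyE x n v (fun _ => 0) (fun _ => 0) i j) := by
  have h : ∀ j ∈ range (n + 1),
      hNode x n j * (F j * DyE x n v (fun _ => 0) (fun _ => 0) i j)
      = F j * (if j < n then v i j else 0) - F j * (if 0 < j then v i (j - 1) else 0) := by
    intro j hj
    rw [mul_left_comm, hNode_mul_DyE hx hn v i j (Nat.lt_succ_iff.1 (mem_range.1 hj)), mul_sub]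
  rw [sum_congr rfl h, sum_sub_distrib, sum_range_succ,
    sum_range_succ' (fun j => F j * if 0 < j then _ else _)]
  simp only [lt_irrefl, if_false, mul_zero, add_zero, Nat.succ_pos, if_true, Nat.add_sub_cancel]
  rw [neg_sub, ← sum_sub_distrib]
  exact sum_congr rfl fun j hj => by rw [if_pos (mem_range.1 hj)]; ring

/-- Pointwise discrete Poincaré inequality. -/
lemma IsGrid.sq_le_sum_diff (hx : IsGrid x n) (e : ℕ → ℝ) (h0 : e 0 = 0) {i : ℕ} (hi : i ≤ n) :
    e i ^ 2 ≤ ∑ k ∈ range n, hMid x k * ((e (k + 1) - e k) / hMid x k) ^ 2 := by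
  have hpos : ∀ k ∈ range n, 0 < hMid x k := fun k hk => hx.hMid_pos (mem_range.1 hk)
  have hsub : range i ⊆ range n := range_subset_range.2 hi
  have he : e i = ∑ k ∈ range i, (e (k + 1) - e k) := by rw [sum_range_sub, h0, sub_zero]
  have hcs := sum_sq_le_sum_mul_sum_of_sq_le_mul (range n) (r := fun k => |e (k + 1) - e k|)
    (f := hMid x) (g := fun k => hMid x k * ((e (k + 1) - e k) / hMid x k) ^ 2)
    (fun k hk => (hpos k hk).le) (fun k hk => mul_nonneg (hpos k hk).le (sq_nonneg _))
    (fun k hk => by have := (hpos k hk).ne'; rw [sq_abs]; field_simp; rfl)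
  rw [hx.sum_hMid, one_mul] at hcs
  refine le_trans ?_ hcs
  rw [← sq_abs (e i)]
  refine pow_le_pow_left₀ (abs_nonneg _) ?_ 2
  rw [he]
  exact (abs_sum_le_sum_abs _ _).trans
    (sum_le_sum_of_subset_of_nonneg hsub fun _ _ _ => abs_nonneg _)

end Grid

section Stability

variable {x y : ℕ → ℝ} {nx ny : ℕ}

lemma ipM_swap (φ θ : ℕ → ℕ → ℝ) :
    ipM x y nx ny φ θ = ipM y x ny nx (fun a b => φ b a) (fun a b => θ b a) := by
  unfold ipM
  rw [sum_comm]
  exact sum_congr rfl fun _ _ => sum_congr rfl fun _ _ => by ring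

lemma ipT_swap (φ θ : ℕ → ℕ → ℝ) :
    ipT x y nx ny φ θ = ipT y x ny nx (fun a b => φ b a) (fun a b => θ b a) := by
  unfold ipT
  rw [sum_comm]
  exact sum_congr rfl fun _ _ => sum_congr rfl fun _ _ => by ring

lemma ipMT_eq_ipTM_swap (φ θ : ℕ → ℕ → ℝ) :
    ipMT x y nx ny φ θ = ipTM y x ny nx (fun a b => φ b a) (fun a b => θ b a) := by
  unfold ipMT ipTM
  rw [sum_comm]
  exact sum_congr rfl fun _ _ => sum_congr rfl fun _ _ => by ring

/-- Discrete integration by parts for one momentum equation. -/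
lemma ipTM_momentum (hx : IsGrid x nx) (hy : IsGrid y ny) (hnx : 1 ≤ nx) (hny : 1 ≤ ny)
    (E F e : ℕ → ℕ → ℝ) (he : ∀ j < ny, e 0 j = 0 ∧ e nx j = 0) :
    ipTM x y nx ny (fun i j => (E i j - E (i - 1) j) / hNode x nx i
        + (F i (j + 1) - F i j) / hMid y j) e
      = -ipM x y nx ny E (fun i j => (e (i + 1) j - e i j) / hMid x i)
        - ipT x y nx ny F (DyE y ny e (fun _ => 0) (fun _ => 0)) := by
  have h1 : ∑ i ∈ Ico 1 nx, ∑ j ∈ range ny, hMid y j * ((E i j - E (i - 1) j) * e i j)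
      = -ipM x y nx ny E (fun i j => (e (i + 1) j - e i j) / hMid x i) := by
    unfold ipM
    rw [sum_comm, sum_comm (s := range nx), ← sum_neg_distrib]
    refine sum_congr rfl fun j hj => ?_
    rw [← mul_sum, sum_Ico_by_parts (fun i => E i j) (fun i => e i j) hnx
      (he j (mem_range.1 hj)).1 (he j (mem_range.1 hj)).2, mul_neg, mul_sum]
    refine congrArg Neg.neg (sum_congr rfl fun i hi => ?_)
    have := (hx.hMid_pos (mem_range.1 hi)).ne'
    field_simp
  have hz : ∀ i, (∀ j < ny, e i j = 0) → ∀ j ≤ ny,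
      DyE y ny e (fun _ => 0) (fun _ => 0) i j = 0 := by
    intro i h j hj
    unfold DyE
    split_ifs with ha hb
    · rw [h 0 (by omega)]; simp
    · rw [h _ (by omega)]; simp
    · rw [h _ (by omega), h _ (by omega)]; simp
  have h2 : ∑ i ∈ Ico 1 nx, ∑ j ∈ range ny, hNode x nx i * ((F i (j + 1) - F i j) * e i j)
      = -ipT x y nx ny F (DyE y ny e (fun _ => 0) (fun _ => 0)) := by
    have hi : ∀ i, ∑ j ∈ range ny, hNode x nx i * ((F i (j + 1) - F i j) * e i j)
        = -∑ j ∈ range (ny + 1), hNode x nx i * hNode y ny j * F i j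
            * DyE y ny e (fun _ => 0) (fun _ => 0) i j := by
      intro i
      rw [← mul_sum, sum_range_by_parts hy hny, mul_neg, mul_sum]
      exact congrArg Neg.neg (sum_congr rfl fun j _ => by ring)
    unfold ipT
    rw [sum_congr rfl fun i _ => hi i, sum_neg_distrib]
    refine congrArg Neg.neg (sum_subset (fun i h => ?_) fun i h h' => sum_eq_zero fun j hj => ?_)
    · rw [mem_Ico] at h
      exact mem_range.2 (by omega)
    · rw [mem_range] at h hj
      rw [mem_Ico] at h'
      rcases (show i = 0 ∨ i = nx by omega) with rfl | rfl
      · rw [hz 0 (fun j hj => (he j hj).1) j (by omega), mul_zero]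
      · rw [hz i (fun j hj => (he j hj).2) j (by omega), mul_zero]
  rw [sub_eq_add_neg, ← h1, ← h2, ← sum_add_distrib]
  unfold ipTM
  refine sum_congr rfl fun i hi => ?_
  rw [← sum_add_distrib]
  refine sum_congr rfl fun j hj => ?_
  have ha := (hx.hNode_pos hnx (mem_Ico.1 hi).2.le).ne'
  have hb := (hy.hMid_pos (mem_range.1 hj)).ne'
  field_simp

/-- Discrete Poincaré inequality. -/
lemma ipTM_le_ipM_diff (hx : IsGrid x nx) (hy : IsGrid y ny) (hnx : 1 ≤ nx)
    (e : ℕ → ℕ → ℝ) (he : ∀ j < ny, e 0 j = 0) :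
    ipTM x y nx ny e e ≤ ipM x y nx ny (fun i j => (e (i + 1) j - e i j) / hMid x i)
      (fun i j => (e (i + 1) j - e i j) / hMid x i) := by
  unfold ipTM ipM
  rw [sum_comm, sum_comm (s := range nx)]
  refine sum_le_sum fun j hj => ?_
  have hl := (hy.hMid_pos (mem_range.1 hj)).le
  set S := ∑ k ∈ range nx, hMid x k * ((e (k + 1) j - e k j) / hMid x k) ^ 2 with hS
  have hS0 : 0 ≤ S := sum_nonneg fun k hk =>
    mul_nonneg (hx.hMid_pos (mem_range.1 hk)).le (sq_nonneg _)
  calc ∑ i ∈ Ico 1 nx, hNode x nx i * hMid y j * e i j * e i j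
      ≤ ∑ i ∈ Ico 1 nx, hNode x nx i * (hMid y j * S) := by
        refine sum_le_sum fun i hi => ?_
        have hi' := (mem_Ico.1 hi).2.le
        have hp := hx.sq_le_sum_diff (fun i => e i j) (he j (mem_range.1 hj)) hi'
        have hn := (hx.hNode_pos hnx hi').le
        calc _ = hNode x nx i * (hMid y j * e i j ^ 2) := by ring
          _ ≤ _ := by gcongr
    _ ≤ 1 * (hMid y j * S) := by
        rw [← sum_mul]
        exact mul_le_mul_of_nonneg_right (hx.sum_hNode_interior_le hnx) (mul_nonneg hl hS0)
    _ = _ := by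
        rw [one_mul, hS, mul_sum]
        exact sum_congr rfl fun _ _ => by ring

lemma sum_sum_hMid (hx : IsGrid x nx) (hy : IsGrid y ny) :
    ∑ i ∈ range nx, ∑ j ∈ range ny, hMid x i * hMid y j = 1 := by
  rw [← sum_mul_sum, hx.sum_hMid, hy.sum_hMid, one_mul]

lemma sum_sum_hNode (hx : IsGrid x nx) (hy : IsGrid y ny) (hnx : 1 ≤ nx) (hny : 1 ≤ ny) :
    ∑ i ∈ range (nx + 1), ∑ j ∈ range (ny + 1), hNode x nx i * hNode y ny j = 1 := by
  rw [← sum_mul_sum, hx.sum_hNode hnx, hy.sum_hNode hny, one_mul]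

lemma ipTM_lower_bound (hx : IsGrid x nx) (hy : IsGrid y ny) (hnx : 1 ≤ nx)
    {R e : ℕ → ℕ → ℝ} {ε δ : ℝ} (hδ : 0 < δ)
    (hR : ∀ i, 1 ≤ i → i < nx → ∀ j < ny, |R i j| ≤ ε) :
    ipTM x y nx ny R e ≤ δ * ipTM x y nx ny e e + ε ^ 2 / (4 * δ) := by
  have hsum : ∑ i ∈ Ico 1 nx, ∑ j ∈ range ny, hNode x nx i * hMid y j ≤ 1 := by
    rw [← sum_mul_sum, hy.sum_hMid, mul_one]
    exact hx.sum_hNode_interior_le hnx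
  calc ipTM x y nx ny R e
      ≤ ∑ i ∈ Ico 1 nx, ∑ j ∈ range ny, (δ * (hNode x nx i * hMid y j * e i j * e i j)
          + hNode x nx i * hMid y j * (ε ^ 2 / (4 * δ))) := by
        refine sum_le_sum fun i hi => sum_le_sum fun j hj => ?_
        rw [mem_Ico] at hi
        have hw : 0 ≤ hNode x nx i * hMid y j :=
          mul_nonneg (hx.hNode_pos hnx hi.2.le).le (hy.hMid_pos (mem_range.1 hj)).le
        have hr : R i j ^ 2 ≤ ε ^ 2 := sq_le_sq' (abs_le.1 (hR i hi.1 hi.2 j (mem_range.1 hj))).1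
          (abs_le.1 (hR i hi.1 hi.2 j (mem_range.1 hj))).2
        have : R i j * e i j ≤ δ * (e i j * e i j) + ε ^ 2 / (4 * δ) := by
          have h : R i j * e i j ≤ δ * (e i j * e i j) + R i j ^ 2 / (4 * δ) := by
            have : δ * (e i j * e i j) + R i j ^ 2 / (4 * δ) - R i j * e i j
                = (2 * δ * e i j - R i j) ^ 2 / (4 * δ) := by field_simp; ring
            have : 0 ≤ (2 * δ * e i j - R i j) ^ 2 / (4 * δ) := by positivity
            linarith
          have : R i j ^ 2 / (4 * δ) ≤ ε ^ 2 / (4 * δ) := by gcongr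
          linarith
        nlinarith [mul_le_mul_of_nonneg_left this hw]
    _ = δ * ipTM x y nx ny e e
          + (∑ i ∈ Ico 1 nx, ∑ j ∈ range ny, hNode x nx i * hMid y j) * (ε ^ 2 / (4 * δ)) := by
        unfold ipTM
        simp only [sum_add_distrib, mul_sum, sum_mul]
    _ ≤ _ := by
        have : 0 ≤ ε ^ 2 / (4 * δ) := by positivity
        nlinarith

lemma cell_coercivity {lam mu ε E F a b : ℝ} (hmu : 0 < mu) (hlam : 0 < lam)
    (hs : |(E - F) / (2 * mu) - (a - b)| ≤ ε)
    (hr : |(E + F) / (2 * (lam + mu)) - (a + b)| ≤ ε / (lam + mu)) :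
    mu / 2 * (a ^ 2 + b ^ 2) ≤ E * a + F * b + (1 / mu + mu) * ε ^ 2 := by
  obtain ⟨s, hs'⟩ : ∃ s, s = (E - F) / (2 * mu) - (a - b) := ⟨_, rfl⟩
  obtain ⟨r, hr'⟩ : ∃ r, r = (E + F) / (2 * (lam + mu)) - (a + b) := ⟨_, rfl⟩
  rw [← hs'] at hs
  rw [← hr'] at hr
  have hA : 0 < lam + mu := by linarith
  have hP' : E - F = 2 * mu * (s + (a - b)) := by rw [hs']; field_simp; ring
  have hT' : E + F = 2 * (lam + mu) * (r + (a + b)) := by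
    rw [hr']; field_simp; ring
  have hs2 : s ^ 2 ≤ ε ^ 2 := sq_le_sq' (abs_le.1 hs).1 (abs_le.1 hs).2
  have hr2 : (lam + mu) * r ^ 2 ≤ 1 / mu * ε ^ 2 := by
    have h := sq_le_sq' (abs_le.1 hr).1 (abs_le.1 hr).2
    calc (lam + mu) * r ^ 2 ≤ (lam + mu) * (ε / (lam + mu)) ^ 2 := by gcongr
      _ = 1 / (lam + mu) * ε ^ 2 := by field_simp
      _ ≤ 1 / mu * ε ^ 2 := by gcongr; linarith
  have hE : E * a + F * b
      = (lam + mu) * (r + (a + b)) * (a + b) + mu * (s + (a - b)) * (a - b) := by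
    linear_combination (a + b) / 2 * hT' + (a - b) / 2 * hP'
  rw [hE]
  have i1 : 0 ≤ (lam + mu) * (r + (a + b) / 2) ^ 2 := by positivity
  have i2 : 0 ≤ mu * (s + (a - b) / 2) ^ 2 := by positivity
  have i3 : 0 ≤ lam * (a + b) ^ 2 := by positivity
  have i4 : mu * s ^ 2 ≤ mu * ε ^ 2 := by gcongr
  have i5 : 0 ≤ mu * (a + b) ^ 2 := by positivity
  have i6 : 0 ≤ mu * (a - b) ^ 2 := by positivity
  nlinarith

lemma node_coercivity {mu ε E a b : ℝ} (hmu : 0 < mu) (hs : |E - mu * (a + b)| ≤ mu * ε) :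
    0 ≤ E * a + E * b + mu / 4 * ε ^ 2 := by
  obtain ⟨r, hr⟩ : ∃ r, r = E - mu * (a + b) := ⟨_, rfl⟩
  rw [← hr] at hs
  have hr2 : r ^ 2 ≤ (mu * ε) ^ 2 := sq_le_sq' (abs_le.1 hs).1 (abs_le.1 hs).2
  have hE : E = mu * (a + b) + r := by rw [hr]; ring
  have : 0 ≤ mu * (E * a + E * b + mu / 4 * ε ^ 2) := by
    rw [hE]
    nlinarith [sq_nonneg (2 * mu * (a + b) + r)]
  exact nonneg_of_mul_nonneg_right this hmu

/-- Stability of the MAC-E scheme, uniform in `lam`, for residuals of size `ε` whose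
contribution to the divergence is of size `ε / (lam + mu)`. -/
lemma mac_stability {lam mu ε : ℝ} (hmu : 0 < mu) (hlam : 0 < lam)
    (hx : IsGrid x nx) (hy : IsGrid y ny) (hnx : 1 ≤ nx) (hny : 1 ≤ ny)
    {ex ey E11 E22 E12 : ℕ → ℕ → ℝ}
    (hex : ∀ j < ny, ex 0 j = 0 ∧ ex nx j = 0) (hey : ∀ i < nx, ey i 0 = 0 ∧ ey i ny = 0)
    (hP : ∀ i < nx, ∀ j < ny, |(E11 i j - E22 i j) / (2 * mu)
      - ((ex (i + 1) j - ex i j) / hMid x i - (ey i (j + 1) - ey i j) / hMid y j)| ≤ ε)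
    (hT : ∀ i < nx, ∀ j < ny, |(E11 i j + E22 i j) / (2 * (lam + mu))
      - ((ex (i + 1) j - ex i j) / hMid x i + (ey i (j + 1) - ey i j) / hMid y j)|
        ≤ ε / (lam + mu))
    (hS : ∀ i ≤ nx, ∀ j ≤ ny, |E12 i j - mu * (DyE y ny ex (fun _ => 0) (fun _ => 0) i j
      + DxE x nx ey (fun _ => 0) (fun _ => 0) i j)| ≤ mu * ε)
    (h4 : ∀ i, 1 ≤ i → i < nx → ∀ j < ny, |(E11 i j - E11 (i - 1) j) / hNode x nx i
      + (E12 i (j + 1) - E12 i j) / hMid y j| ≤ ε)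
    (h5 : ∀ i < nx, ∀ j, 1 ≤ j → j < ny → |(E12 (i + 1) j - E12 i j) / hMid x i
      + (E22 i j - E22 i (j - 1)) / hNode y ny j| ≤ ε) :
    ipTM x y nx ny ex ex + ipMT x y nx ny ey ey ≤ (12 / mu ^ 2 + 5) * ε ^ 2 := by
  set dx : ℕ → ℕ → ℝ := fun i j => (ex (i + 1) j - ex i j) / hMid x i with hdx
  set dy : ℕ → ℕ → ℝ := fun i j => (ey i (j + 1) - ey i j) / hMid y j with hdy
  set gx : ℕ → ℕ → ℝ := DyE y ny ex (fun _ => 0) (fun _ => 0) with hgx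
  set gy : ℕ → ℕ → ℝ := DxE x nx ey (fun _ => 0) (fun _ => 0) with hgy
  have hX : ipTM x y nx ny (fun i j => (E11 i j - E11 (i - 1) j) / hNode x nx i
        + (E12 i (j + 1) - E12 i j) / hMid y j) ex
      = -ipM x y nx ny E11 dx - ipT x y nx ny E12 gx :=
    ipTM_momentum hx hy hnx hny E11 E12 ex hex
  have hY := ipTM_momentum hy hx hny hnx (fun a b => E22 b a) (fun a b => E12 b a)
    (fun a b => ey b a) hey
  have hY' : ipTM y x ny nx (fun j i => (E22 i j - E22 i (j - 1)) / hNode y ny j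
        + (E12 (i + 1) j - E12 i j) / hMid x i) (fun j i => ey i j)
      = -ipM x y nx ny E22 dy - ipT x y nx ny E12 gy := by
    rw [ipM_swap, ipT_swap]
    exact hY
  have bX := ipTM_lower_bound (e := fun i j => -ex i j) hx hy hnx (δ := mu / 4) (by positivity) h4
  have bY := ipTM_lower_bound (e := fun j i => -ey i j) hy hx hny (δ := mu / 4) (ε := ε)
    (R := fun j i => (E22 i j - E22 i (j - 1)) / hNode y ny j
        + (E12 (i + 1) j - E12 i j) / hMid x i) (by positivity)
    (fun j h1 h2 i hi => by rw [add_comm]; exact h5 i hi j h1 h2)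
  have neg1 : ∀ (a b : ℕ → ℝ) (m n : ℕ) (R e : ℕ → ℕ → ℝ),
      ipTM a b m n R (fun i j => -e i j) = -ipTM a b m n R e := by
    intro a b m n R e
    simp [ipTM]
  have neg2 : ∀ (a b : ℕ → ℝ) (m n : ℕ) (e : ℕ → ℕ → ℝ),
      ipTM a b m n (fun i j => -e i j) (fun i j => -e i j) = ipTM a b m n e e := by
    intro a b m n e
    simp [ipTM]
  rw [neg1 x y nx ny _ ex, neg2 x y nx ny ex, hX] at bX
  rw [neg1 y x ny nx _ (fun j i => ey i j), neg2 y x ny nx (fun j i => ey i j), hY'] at bY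
  have pX : ipTM x y nx ny ex ex ≤ ipM x y nx ny dx dx :=
    ipTM_le_ipM_diff hx hy hnx ex (fun j hj => (hex j hj).1)
  have pY := ipTM_le_ipM_diff hy hx hny (fun a b => ey b a) (fun j hj => (hey j hj).1)
  have pY' : ipTM y x ny nx (fun j i => ey i j) (fun j i => ey i j) ≤ ipM x y nx ny dy dy := by
    rw [ipM_swap]
    exact pY
  rw [ipMT_eq_ipTM_swap]
  replace hP : ∀ i < nx, ∀ j < ny, |(E11 i j - E22 i j) / (2 * mu) - (dx i j - dy i j)| ≤ ε := hP
  replace hT : ∀ i < nx, ∀ j < ny, |(E11 i j + E22 i j) / (2 * (lam + mu)) - (dx i j + dy i j)|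
      ≤ ε / (lam + mu) := hT
  replace hS : ∀ i ≤ nx, ∀ j ≤ ny, |E12 i j - mu * (gx i j + gy i j)| ≤ mu * ε := hS
  clear hdx hdy hgx hgy
  clear_value dx dy gx gy
  have cell : mu / 2 * (ipM x y nx ny dx dx + ipM x y nx ny dy dy)
      ≤ ipM x y nx ny E11 dx + ipM x y nx ny E22 dy + (1 / mu + mu) * ε ^ 2 := by
    have : (1 / mu + mu) * ε ^ 2 = ∑ i ∈ range nx, ∑ j ∈ range ny,
        hMid x i * hMid y j * ((1 / mu + mu) * ε ^ 2) := by
      simp only [← sum_mul]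
      rw [sum_sum_hMid hx hy, one_mul]
    rw [this]
    unfold ipM
    simp only [← sum_add_distrib, mul_sum]
    refine sum_le_sum fun i hi => sum_le_sum fun j hj => ?_
    rw [mem_range] at hi hj
    have hw : 0 ≤ hMid x i * hMid y j := mul_nonneg (hx.hMid_pos hi).le (hy.hMid_pos hj).le
    have key : mu / 2 * (dx i j ^ 2 + dy i j ^ 2)
        ≤ E11 i j * dx i j + E22 i j * dy i j + (1 / mu + mu) * ε ^ 2 := by
      have hs := hP i hi j hj
      have hr := hT i hi j hj
      exact cell_coercivity hmu hlam hs hr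
    nlinarith [mul_le_mul_of_nonneg_left key hw]
  have node : 0 ≤ ipT x y nx ny E12 gx + ipT x y nx ny E12 gy + mu / 4 * ε ^ 2 := by
    have : mu / 4 * ε ^ 2 = ∑ i ∈ range (nx + 1), ∑ j ∈ range (ny + 1),
        hNode x nx i * hNode y ny j * (mu / 4 * ε ^ 2) := by
      simp only [← sum_mul]
      rw [sum_sum_hNode hx hy hnx hny, one_mul]
    rw [this]
    unfold ipT
    simp only [← sum_add_distrib]
    refine sum_nonneg fun i hi => sum_nonneg fun j hj => ?_
    rw [mem_range] at hi hj
    have hw : 0 ≤ hNode x nx i * hNode y ny j :=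
      mul_nonneg (hx.hNode_pos hnx (by omega)).le (hy.hNode_pos hny (by omega)).le
    have key : 0 ≤ E12 i j * gx i j + E12 i j * gy i j + mu / 4 * ε ^ 2 := by
      have hs := hS i (by omega) j (by omega)
      exact node_coercivity hmu hs
    nlinarith [mul_nonneg hw key]
  have hfin : mu / 4 * (ipTM x y nx ny ex ex + ipTM y x ny nx (fun j i => ey i j) fun j i => ey i j)
      ≤ mu / 4 * ((12 / mu ^ 2 + 5) * ε ^ 2) := by
    have e1 : mu / 4 * ((12 / mu ^ 2 + 5) * ε ^ 2)
        = (1 / mu + mu) * ε ^ 2 + mu / 4 * ε ^ 2 + 2 * (ε ^ 2 / (4 * (mu / 4))) := by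
      field_simp; ring
    rw [e1]
    generalize ipTM x y nx ny ex ex = tx at *
    generalize ipTM y x ny nx (fun j i => ey i j) (fun j i => ey i j) = ty at *
    have m1 := mul_le_mul_of_nonneg_left pX (show 0 ≤ mu / 2 by positivity)
    have m2 := mul_le_mul_of_nonneg_left pY' (show 0 ≤ mu / 2 by positivity)
    linarith
  exact le_of_mul_le_mul_left hfin (by positivity)

end Stability

section Interpolant

/-- Derivatives of a displacement component `f`, with a function `g` that cancels `∂ₓ∂ᵧ²f` up to
`Nd`: for `f = uˣ`, `g` is `∂ᵧ³uʸ` and the sum is `∂ᵧ² div u`. -/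
structure IsDisplacementJet (f fx fxx fxxx fy fyy fyyy fyyx g : ℝ → ℝ → ℝ) (N Nd : ℝ) : Prop where
  dx : ∀ s t, HasDerivAt (fun s => f s t) (fx s t) s
  dxx : ∀ s t, HasDerivAt (fun s => fx s t) (fxx s t) s
  dxxx : ∀ s t, HasDerivAt (fun s => fxx s t) (fxxx s t) s
  dy : ∀ s t, HasDerivAt (fun t => f s t) (fy s t) t
  dyy : ∀ s t, HasDerivAt (fun t => fy s t) (fyy s t) t
  dyyy : ∀ s t, HasDerivAt (fun t => fyy s t) (fyyy s t) t
  dyyx : ∀ s t, HasDerivAt (fun s => fyy s t) (fyyx s t) s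
  fxxx_le : ∀ s ∈ Set.Icc (0 : ℝ) 1, ∀ t ∈ Set.Icc (0 : ℝ) 1, |fxxx s t| ≤ N
  fyy_le : ∀ s ∈ Set.Icc (0 : ℝ) 1, ∀ t ∈ Set.Icc (0 : ℝ) 1, |fyy s t| ≤ N
  fyyy_le : ∀ s ∈ Set.Icc (0 : ℝ) 1, ∀ t ∈ Set.Icc (0 : ℝ) 1, |fyyy s t| ≤ N
  fyyx_le : ∀ s ∈ Set.Icc (0 : ℝ) 1, ∀ t ∈ Set.Icc (0 : ℝ) 1, |fyyx s t| ≤ N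
  g_le : ∀ s ∈ Set.Icc (0 : ℝ) 1, ∀ t ∈ Set.Icc (0 : ℝ) 1, |g s t| ≤ N
  g_lip : ∀ s ∈ Set.Icc (0 : ℝ) 1, ∀ s' ∈ Set.Icc (0 : ℝ) 1, ∀ t ∈ Set.Icc (0 : ℝ) 1,
    |g s t - g s' t| ≤ N * |s - s'|
  div_le : ∀ s ∈ Set.Icc (0 : ℝ) 1, ∀ t ∈ Set.Icc (0 : ℝ) 1, |fyyx s t + g s t| ≤ Nd
  f_left : ∀ t ∈ Set.Icc (0 : ℝ) 1, f 0 t = 0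
  f_right : ∀ t ∈ Set.Icc (0 : ℝ) 1, f 1 t = 0
  f_bot : ∀ s ∈ Set.Icc (0 : ℝ) 1, f s 0 = 0
  f_top : ∀ s ∈ Set.Icc (0 : ℝ) 1, f s 1 = 0
  fyy_left : ∀ t ∈ Set.Ioo (0 : ℝ) 1, fyy 0 t = 0
  fyy_right : ∀ t ∈ Set.Ioo (0 : ℝ) 1, fyy 1 t = 0
  g_left : ∀ t ∈ Set.Ioo (0 : ℝ) 1, g 0 t = 0
  g_right : ∀ t ∈ Set.Ioo (0 : ℝ) 1, g 1 t = 0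

/-- A smooth step from `0` to `1` that is flat at both ends. -/
def smoothStep (t : ℝ) : ℝ := 3 * t ^ 2 - 2 * t ^ 3

/-- Difference quotients of `smoothStep` on the cells. -/
def stepSlope (y : ℕ → ℝ) (j : ℕ) : ℝ :=
  3 * (y (j + 1) + y j) - 2 * (y (j + 1) ^ 2 + y j * y (j + 1) + y j ^ 2)

/-- The sum of `l³ r` over all cells. -/
def cubeSum (y : ℕ → ℝ) (n : ℕ) (r : ℕ → ℝ) : ℝ := ∑ k ∈ range n, hMid y k ^ 3 * r k

/-- Discrete antiderivative of `l² r / 6`, corrected to vanish at both ends. -/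
def cubePrimitive (y : ℕ → ℝ) (n : ℕ) (r : ℕ → ℝ) (j : ℕ) : ℝ :=
  (cubeSum y j r - smoothStep (y j) * cubeSum y n r) / 6

/-- Mean value over a cell. -/
def cellMean (y : ℕ → ℝ) (v : ℝ → ℝ) (j : ℕ) : ℝ := (∫ t in y j..y (j + 1), v t) / hMid y j

variable {x y : ℕ → ℝ} {nx ny n : ℕ} {H C0 N Nd : ℝ}

lemma smoothStep_sub (y : ℕ → ℝ) (j : ℕ) :
    smoothStep (y (j + 1)) - smoothStep (y j) = hMid y j * stepSlope y j := by
  unfold smoothStep hMid stepSlope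
  ring

lemma abs_smoothStep_le {t : ℝ} (ht : t ∈ Set.Icc (0 : ℝ) 1) : |smoothStep t| ≤ 1 := by
  obtain ⟨h0, h1⟩ := ht
  unfold smoothStep
  rw [abs_le]
  constructor
  · nlinarith [mul_nonneg (sq_nonneg t) (sub_nonneg.2 h1)]
  · nlinarith [mul_nonneg (sq_nonneg (1 - t)) (by linarith : (0 : ℝ) ≤ 1 + 2 * t)]

lemma abs_stepSlope_le (hy : IsGrid y n) {j : ℕ} (hj : j < n) : |stepSlope y j| ≤ 6 := by
  obtain ⟨h0, h1⟩ := hy.mem_Icc hj.le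
  obtain ⟨h2, h3⟩ := hy.mem_Icc (Nat.succ_le_of_lt hj)
  unfold stepSlope
  rw [abs_le]
  constructor <;> nlinarith [mul_nonneg h0 h2]

lemma abs_stepSlope_sub_left_le (hy : IsGrid y n) {j : ℕ} (hj : j < n) :
    |stepSlope y j - 6 * y j * (1 - y j)| ≤ 3 * hMid y j := by
  obtain ⟨h0, h1⟩ := hy.mem_Icc hj.le
  obtain ⟨h2, h3⟩ := hy.mem_Icc (Nat.succ_le_of_lt hj)
  have hp := hy.hMid_pos hj
  have : stepSlope y j - 6 * y j * (1 - y j) = (3 - 2 * (y (j + 1) + 2 * y j)) * hMid y j := by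
    unfold stepSlope hMid; ring
  rw [this, abs_mul, abs_of_pos hp]
  refine mul_le_mul_of_nonneg_right (abs_le.2 ⟨by linarith, by linarith⟩) hp.le

lemma abs_stepSlope_sub_right_le (hy : IsGrid y n) {j : ℕ} (hj : j < n) :
    |stepSlope y j - 6 * y (j + 1) * (1 - y (j + 1))| ≤ 3 * hMid y j := by
  obtain ⟨h0, h1⟩ := hy.mem_Icc hj.le
  obtain ⟨h2, h3⟩ := hy.mem_Icc (Nat.succ_le_of_lt hj)
  have hp := hy.hMid_pos hj
  have : stepSlope y j - 6 * y (j + 1) * (1 - y (j + 1))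
      = -((3 - 2 * (y j + 2 * y (j + 1))) * hMid y j) := by
    unfold stepSlope hMid; ring
  rw [this, abs_neg, abs_mul, abs_of_pos hp]
  refine mul_le_mul_of_nonneg_right (abs_le.2 ⟨by linarith, by linarith⟩) hp.le

lemma abs_cubeSum_le (hy : IsGrid y n) (hH : ∀ j < n, hMid y j ≤ H)
    {r : ℕ → ℝ} (hr : ∀ k < n, |r k| ≤ N) {j : ℕ} (hj : j ≤ n) :
    |cubeSum y j r| ≤ H ^ 2 * N := by
  unfold cubeSum
  calc |∑ k ∈ range j, hMid y k ^ 3 * r k|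
      ≤ ∑ k ∈ range j, |hMid y k ^ 3 * r k| := abs_sum_le_sum_abs _ _
    _ ≤ ∑ k ∈ range n, |hMid y k ^ 3 * r k| :=
        sum_le_sum_of_subset_of_nonneg (range_subset_range.2 hj) fun _ _ _ => abs_nonneg _
    _ ≤ ∑ k ∈ range n, hMid y k * (H ^ 2 * N) := by
        refine sum_le_sum fun k hk => ?_
        rw [mem_range] at hk
        have hp := (hy.hMid_pos hk).le
        have h1 := hH k hk
        have h2 := hr k hk
        rw [abs_mul, abs_of_nonneg (by positivity)]
        calc hMid y k ^ 3 * |r k| = hMid y k * (hMid y k ^ 2 * |r k|) := by ring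
          _ ≤ _ := by gcongr
    _ = _ := by rw [← sum_mul, hy.sum_hMid, one_mul]

lemma cubeSum_sub (j : ℕ) (r s : ℕ → ℝ) :
    cubeSum y j (fun k => r k - s k) = cubeSum y j r - cubeSum y j s := by
  simp only [cubeSum, mul_sub, sum_sub_distrib]

lemma cubeSum_div (j : ℕ) (r : ℕ → ℝ) (c : ℝ) :
    cubeSum y j (fun k => r k / c) = cubeSum y j r / c := by
  simp only [cubeSum, sum_div, mul_div_assoc]

lemma cubePrimitive_sub (j : ℕ) (r s : ℕ → ℝ) :
    cubePrimitive y n (fun k => r k - s k) j = cubePrimitive y n r j - cubePrimitive y n s j := by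
  simp only [cubePrimitive, cubeSum_sub]
  ring

lemma abs_cubePrimitive_le (hy : IsGrid y n) (hH : ∀ j < n, hMid y j ≤ H) (hN : 0 ≤ N)
    {r : ℕ → ℝ} (hr : ∀ k < n, |r k| ≤ N) {j : ℕ} (hj : j ≤ n) :
    |cubePrimitive y n r j| ≤ H ^ 2 * N := by
  have h1 := abs_cubeSum_le hy hH hr hj
  have h2 := abs_cubeSum_le hy hH hr le_rfl
  have h3 := abs_smoothStep_le (hy.mem_Icc hj)
  have h4 : |smoothStep (y j) * cubeSum y n r| ≤ 1 * (H ^ 2 * N) := by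
    rw [abs_mul]; gcongr
  unfold cubePrimitive
  rw [abs_div, abs_of_pos (by norm_num : (0 : ℝ) < 6), div_le_iff₀ (by norm_num)]
  have := abs_sub (cubeSum y j r) (smoothStep (y j) * cubeSum y n r)
  nlinarith [sq_nonneg H]

lemma cubePrimitive_zero (hy : IsGrid y n) (r : ℕ → ℝ) : cubePrimitive y n r 0 = 0 := by
  simp [cubePrimitive, cubeSum, smoothStep, hy.1]

lemma cubePrimitive_last (hy : IsGrid y n) (r : ℕ → ℝ) : cubePrimitive y n r n = 0 := by
  simp only [cubePrimitive, smoothStep, hy.2.1]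
  ring

lemma cubePrimitive_diff (hy : IsGrid y n) (r : ℕ → ℝ) {j : ℕ} (hj : j < n) :
    (cubePrimitive y n r (j + 1) - cubePrimitive y n r j) / hMid y j
      = (hMid y j ^ 2 * r j - stepSlope y j * cubeSum y n r) / 6 := by
  have h1 : cubeSum y (j + 1) r = cubeSum y j r + hMid y j ^ 3 * r j := by
    simp only [cubeSum, sum_range_succ]
  have h2 := smoothStep_sub y j
  have hp := (hy.hMid_pos hj).ne'
  simp only [cubePrimitive, h1]
  rw [div_eq_iff hp]
  linear_combination -(cubeSum y n r) / 6 * h2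

/-- Consistency of the nodal difference quotient from one-sided expansions. -/
lemma abs_DyE_sub_le (hy : IsGrid y n) (hn : 1 ≤ n) (hC : ∀ j < n, C0 * H ≤ hMid y j)
    (hCH : 0 < C0 * H) {v : ℕ → ℕ → ℝ} {i : ℕ} {w c : ℕ → ℝ} {B : ℝ}
    (h0 : w 0 = 0) (h1 : w n = 0)
    (hl : ∀ j < n, |v i j - w j - hMid y j / 2 * c j| ≤ B)
    (hr : ∀ j < n, |v i j - w (j + 1) + hMid y j / 2 * c (j + 1)| ≤ B) {j : ℕ} (hj : j ≤ n) :
    |DyE y n v (fun _ => 0) (fun _ => 0) i j - c j| ≤ 4 * B / (C0 * H) := by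
  have hB : 0 ≤ B := (abs_nonneg _).trans (hl 0 (by omega))
  have hp := hy.hNode_pos hn hj
  have hlow : C0 * H / 2 ≤ hNode y n j := by
    rw [hNode_eq hn j hj]
    split_ifs with h1 h2 h2
    · linarith [hC j h1, hC (j - 1) (by omega)]
    · linarith [hC j h1]
    · linarith [hC (j - 1) (by omega)]
    · omega
  have key : |hNode y n j * (DyE y n v (fun _ => 0) (fun _ => 0) i j - c j)| ≤ 2 * B := by
    rw [mul_sub, hNode_mul_DyE hy hn v i j hj, hNode_eq hn j hj]
    rcases Nat.eq_zero_or_pos j with rfl | hj0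
    · have := hl 0 (by omega)
      rw [h0] at this
      simp only [show 0 < n by omega, if_true, lt_irrefl, if_false]
      rw [abs_le] at *
      constructor <;> linarith
    · obtain ⟨k, rfl⟩ : ∃ k, j = k + 1 := ⟨j - 1, by omega⟩
      have hrk := hr k (by omega)
      simp only [Nat.succ_pos, if_true, Nat.add_sub_cancel]
      split_ifs with h
      · have hlk := hl (k + 1) h
        rw [abs_le] at *
        constructor <;> linarith
      · obtain rfl : k + 1 = n := by omega
        rw [h1] at hrk
        rw [abs_le] at *
        constructor <;> linarith
  rw [abs_mul, abs_of_pos hp] at key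
  rw [le_div_iff₀ hCH]
  nlinarith [abs_nonneg (DyE y n v (fun _ => 0) (fun _ => 0) i j - c j)]

lemma abs_cellMean_sub_le {v v₁ v₂ v₃ : ℝ → ℝ} (hy : IsGrid y n) {j : ℕ} (hj : j < n)
    (h₁ : ∀ t, HasDerivAt v (v₁ t) t) (h₂ : ∀ t, HasDerivAt v₁ (v₂ t) t)
    (h₃ : ∀ t, HasDerivAt v₂ (v₃ t) t) (hM : ∀ t ∈ Set.Icc (0 : ℝ) 1, |v₃ t| ≤ N) :
    |cellMean y v j - v (midpt y j) - hMid y j ^ 2 / 24 * v₂ (midpt y j)|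
      ≤ N * hMid y j ^ 3 := by
  have hc : Continuous v := continuous_iff_continuousAt.2 fun t => (h₁ t).continuousAt
  have hp := hy.hMid_pos hj
  have h := abs_mean_expansion_le (a := y j) (b := y (j + 1)) (hy.2.2 j hj).le
    (v := fun t => ∫ s in y j..t, v s) (fun t => hc.integral_hasStrictDerivAt _ t |>.hasDerivAt)
    h₁ h₂ h₃ (M := N) (fun t ht => hM t ⟨(hy.mem_Icc hj.le).1.trans ht.1,
      ht.2.trans (hy.mem_Icc (Nat.succ_le_of_lt hj)).2⟩)
  rw [intervalIntegral.integral_same, sub_zero] at h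
  change |_ - hMid y j * v (midpt y j) - hMid y j ^ 3 / 24 * v₂ (midpt y j)| ≤ N * hMid y j ^ 4 at h
  have e : (∫ s in y j..y (j + 1), v s) = hMid y j * cellMean y v j := by
    unfold cellMean; field_simp
  rw [e, show hMid y j * cellMean y v j - hMid y j * v (midpt y j)
    - hMid y j ^ 3 / 24 * v₂ (midpt y j) = hMid y j * (cellMean y v j - v (midpt y j)
      - hMid y j ^ 2 / 24 * v₂ (midpt y j)) by ring, abs_mul, abs_of_pos hp,
    show N * hMid y j ^ 4 = hMid y j * (N * hMid y j ^ 3) by ring] at h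
  exact le_of_mul_le_mul_left h hp

lemma abs_cellMean_sub_midpt_le {v v₁ v₂ : ℝ → ℝ} (hy : IsGrid y n) {j : ℕ} (hj : j < n)
    (h₁ : ∀ t, HasDerivAt v (v₁ t) t) (h₂ : ∀ t, HasDerivAt v₁ (v₂ t) t)
    (hM : ∀ t ∈ Set.Icc (0 : ℝ) 1, |v₂ t| ≤ N) :
    |cellMean y v j - v (midpt y j)| ≤ N * hMid y j ^ 2 := by
  have hc : Continuous v := continuous_iff_continuousAt.2 fun t => (h₁ t).continuousAt
  have hp := hy.hMid_pos hj
  have h := abs_midpoint_difference_le (a := y j) (b := y (j + 1)) (hy.2.2 j hj).le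
    (v := fun t => ∫ s in y j..t, v s) (fun t => hc.integral_hasStrictDerivAt _ t |>.hasDerivAt)
    h₁ h₂ (M := N) (fun t ht => hM t ⟨(hy.mem_Icc hj.le).1.trans ht.1,
      ht.2.trans (hy.mem_Icc (Nat.succ_le_of_lt hj)).2⟩)
  rw [intervalIntegral.integral_same, sub_zero] at h
  change |_ - hMid y j * v (midpt y j)| ≤ N * hMid y j ^ 3 at h
  have e : (∫ s in y j..y (j + 1), v s) = hMid y j * cellMean y v j := by
    unfold cellMean; field_simp
  rw [e, ← mul_sub, abs_mul, abs_of_pos hp,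
    show N * hMid y j ^ 3 = hMid y j * (N * hMid y j ^ 2) by ring] at h
  exact le_of_mul_le_mul_left h hp

end Interpolant

section Construction

/-- Consistency of a pair of edge functions `a`, `b` with the displacement component `f`: here `a`
approximates `f`, while `b` is a small correction of the other component. -/
structure IsInterpolant (x y : ℕ → ℝ) (nx ny : ℕ) (f fx fy : ℝ → ℝ → ℝ) (a b : ℕ → ℕ → ℝ)
    (R Rd : ℝ) : Prop where
  a_bdry : ∀ j < ny, a 0 j = 0 ∧ a nx j = 0
  b_bdry : ∀ i < nx, b i 0 = 0 ∧ b i ny = 0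
  a_sub : ∀ i ≤ nx, ∀ j < ny, |a i j - f (x i) (midpt y j)| ≤ R
  b_le : ∀ i < nx, ∀ j ≤ ny, |b i j| ≤ R
  dx_a : ∀ i < nx, ∀ j < ny,
    |(a (i + 1) j - a i j) / hMid x i - fx (midpt x i) (midpt y j)| ≤ R
  dy_b : ∀ i < nx, ∀ j < ny, |(b i (j + 1) - b i j) / hMid y j| ≤ R
  div : ∀ i < nx, ∀ j < ny,
    |(a (i + 1) j - a i j) / hMid x i + (b i (j + 1) - b i j) / hMid y j
      - cellMean y (fun t => f (x (i + 1)) t - f (x i) t) j / hMid x i| ≤ Rd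
  dy_a : ∀ i ≤ nx, ∀ j ≤ ny, |DyE y ny a (fun _ => 0) (fun _ => 0) i j - fy (x i) (y j)| ≤ R
  dx_b : ∀ i ≤ nx, ∀ j ≤ ny, |DxE x nx b (fun _ => 0) (fun _ => 0) i j| ≤ R

/-- Cell means of `f` with a second-order correction. -/
def correctedMean (x y : ℕ → ℝ) (n : ℕ) (f fyy : ℝ → ℝ → ℝ) (i j : ℕ) : ℝ :=
  cellMean y (f (x i)) j - hMid y j ^ 2 / 6 * fyy (x i) (midpt y j)
    + stepSlope y j / 6 * cubeSum y n (fun k => fyy (x i) (midpt y k))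

variable {x y : ℕ → ℝ} {nx ny n : ℕ} {H C0 N Nd : ℝ}
  {f fx fxx fxxx fy fyy fyyy fyyx g : ℝ → ℝ → ℝ}

lemma cellMean_zero {v : ℝ → ℝ} (hy : IsGrid y n) {j : ℕ} (hj : j < n)
    (hv : ∀ t ∈ Set.Icc (0 : ℝ) 1, v t = 0) : cellMean y v j = 0 := by
  unfold cellMean
  rw [intervalIntegral.integral_congr (g := fun _ => (0 : ℝ))]
  · simp
  · intro t ht
    rw [Set.uIcc_of_le (hy.2.2 j hj).le] at ht
    exact hv t ⟨(hy.mem_Icc hj.le).1.trans ht.1, ht.2.trans (hy.mem_Icc (Nat.succ_le_of_lt hj)).2⟩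

lemma cubeSum_zero {r : ℕ → ℝ} {j : ℕ} (hj : j ≤ n) (hr : ∀ k < n, r k = 0) :
    cubeSum y j r = 0 :=
  sum_eq_zero fun k hk => by rw [hr k ((mem_range.1 hk).trans_le hj), mul_zero]

lemma cubePrimitive_eq_zero {r : ℕ → ℝ} {j : ℕ} (hj : j ≤ n) (hr : ∀ k < n, r k = 0) :
    cubePrimitive y n r j = 0 := by
  simp [cubePrimitive, cubeSum_zero hj hr, cubeSum_zero le_rfl hr]

lemma correctedMean_zero (hy : IsGrid y n) {i j : ℕ} (hj : j < n)
    (hf : ∀ t ∈ Set.Icc (0 : ℝ) 1, f (x i) t = 0)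
    (hfyy : ∀ t ∈ Set.Ioo (0 : ℝ) 1, fyy (x i) t = 0) :
    correctedMean x y n f fyy i j = 0 := by
  have h := cubeSum_zero (y := y) (n := n) le_rfl
    fun k (hk : k < n) => hfyy _ (hy.midpt_mem hk)
  simp [correctedMean, h, cellMean_zero hy hj hf, hfyy _ (hy.midpt_mem hj)]

lemma abs_correction_le (hy : IsGrid y n) (hH : ∀ j < n, hMid y j ≤ H) (hN : 0 ≤ N)
    {r : ℕ → ℝ} (hr : ∀ k < n, |r k| ≤ N) {j : ℕ} (hj : j < n) :
    |-(hMid y j ^ 2 / 6 * r j) + stepSlope y j / 6 * cubeSum y n r| ≤ 2 * H ^ 2 * N := by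
  have hp := (hy.hMid_pos hj).le
  have hjH := hH j hj
  have h1 : |hMid y j ^ 2 / 6 * r j| ≤ H ^ 2 / 6 * N := by
    rw [abs_mul, abs_of_nonneg (by positivity)]
    have := hr j hj
    gcongr
  have h2 : |stepSlope y j / 6 * cubeSum y n r| ≤ 6 / 6 * (H ^ 2 * N) := by
    rw [abs_mul, abs_div, abs_of_pos (by norm_num : (0 : ℝ) < 6)]
    have := abs_stepSlope_le hy hj
    have := abs_cubeSum_le hy hH hr le_rfl
    gcongr
  have h3 := abs_add_le (-(hMid y j ^ 2 / 6 * r j)) (stepSlope y j / 6 * cubeSum y n r)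
  rw [abs_neg] at h3
  nlinarith [mul_nonneg (sq_nonneg H) hN]

lemma abs_correctedMean_sub_le (hf : IsDisplacementJet f fx fxx fxxx fy fyy fyyy fyyx g N Nd)
    (hx : IsGrid x nx) (hy : IsGrid y ny) (hH : ∀ j < ny, hMid y j ≤ H) (hN : 0 ≤ N)
    {i j : ℕ} (hi : i ≤ nx) (hj : j < ny) :
    |correctedMean x y ny f fyy i j - f (x i) (midpt y j)| ≤ 3 * H ^ 2 * N := by
  have hp := (hy.hMid_pos hj).le
  have hjH := hH j hj
  have h1 := abs_cellMean_sub_midpt_le hy hj (hf.dy (x i)) (hf.dyy (x i))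
    (hf.fyy_le _ (hx.mem_Icc hi))
  have h2 := abs_correction_le hy hH hN (r := fun k => fyy (x i) (midpt y k))
    (fun k hk => hf.fyy_le _ (hx.mem_Icc hi) _ (Set.Ioo_subset_Icc_self (hy.midpt_mem hk))) hj
  have h3 : N * hMid y j ^ 2 ≤ N * H ^ 2 := by gcongr
  have h4 := abs_add_le (cellMean y (f (x i)) j - f (x i) (midpt y j))
    (-(hMid y j ^ 2 / 6 * fyy (x i) (midpt y j))
      + stepSlope y j / 6 * cubeSum y ny (fun k => fyy (x i) (midpt y k)))
  unfold correctedMean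
  calc _ = _ := by congr 1; ring
    _ ≤ _ := h4
    _ ≤ _ := by linarith

lemma correctedMean_diff (x y : ℕ → ℝ) (n : ℕ) (f fyy : ℝ → ℝ → ℝ) (i j : ℕ) :
    (correctedMean x y n f fyy (i + 1) j - correctedMean x y n f fyy i j) / hMid x i
      = (cellMean y (f (x (i + 1))) j - cellMean y (f (x i)) j) / hMid x i
        + (-(hMid y j ^ 2 / 6
            * ((fyy (x (i + 1)) (midpt y j) - fyy (x i) (midpt y j)) / hMid x i))
          + stepSlope y j / 6 * cubeSum y n
            (fun k => (fyy (x (i + 1)) (midpt y k) - fyy (x i) (midpt y k)) / hMid x i)) := by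
  rw [cubeSum_div (c := hMid x i), cubeSum_sub]
  unfold correctedMean
  ring

/-- The cell-mean difference quotient agrees with the mean of the difference. -/
lemma IsDisplacementJet.cellMean_sub
    (hf : IsDisplacementJet f fx fxx fxxx fy fyy fyyy fyyx g N Nd) (s s' : ℝ) (j : ℕ) :
    cellMean y (fun t => f s t - f s' t) j = cellMean y (f s) j - cellMean y (f s') j := by
  have hc : ∀ s, Continuous (f s) := fun s =>
    continuous_iff_continuousAt.2 fun t => (hf.dy s t).continuousAt
  unfold cellMean
  rw [intervalIntegral.integral_sub ((hc s).intervalIntegrable _ _)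
    ((hc s').intervalIntegrable _ _), sub_div]

lemma IsDisplacementJet.abs_fyy_slope_le
    (hf : IsDisplacementJet f fx fxx fxxx fy fyy fyyy fyyx g N Nd) (hx : IsGrid x nx)
    (hy : IsGrid y ny) {i k : ℕ} (hi : i < nx) (hk : k < ny) :
    |(fyy (x (i + 1)) (midpt y k) - fyy (x i) (midpt y k)) / hMid x i| ≤ N := by
  have hp := hx.hMid_pos hi
  have h := abs_sub_le_of_hasDerivAt (a := x i) (b := x (i + 1)) (C := N)
    (fun s _ => hf.dyyx s (midpt y k)) (fun s hs => by
      rw [Set.uIcc_of_le (hx.2.2 i hi).le] at hs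
      exact hf.fyyx_le _ ⟨(hx.mem_Icc hi.le).1.trans hs.1,
        hs.2.trans (hx.mem_Icc (Nat.succ_le_of_lt hi)).2⟩ _
        (Set.Ioo_subset_Icc_self (hy.midpt_mem hk)))
  rw [abs_div, abs_of_pos hp, div_le_iff₀ hp]
  rwa [show x (i + 1) - x i = hMid x i from rfl, abs_of_pos hp] at h

lemma abs_correctedMean_diff_sub_le
    (hf : IsDisplacementJet f fx fxx fxxx fy fyy fyyy fyyx g N Nd)
    (hx : IsGrid x nx) (hy : IsGrid y ny) (hHx : ∀ i < nx, hMid x i ≤ H)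
    (hHy : ∀ j < ny, hMid y j ≤ H) (hCx : ∀ i < nx, C0 * H ≤ hMid x i) (hC0 : 0 < C0)
    (hH : 0 < H) (hN : 0 ≤ N) {i j : ℕ} (hi : i < nx) (hj : j < ny) :
    |(correctedMean x y ny f fyy (i + 1) j - correctedMean x y ny f fyy i j) / hMid x i
      - fx (midpt x i) (midpt y j)| ≤ (2 / C0 + 4) * H ^ 2 * N := by
  have hpx := hx.hMid_pos hi
  have hpy := (hy.hMid_pos hj).le
  have hiH := hHx i hi
  have hjH := hHy j hj
  have hiC := hCx i hi
  have hm := Set.Ioo_subset_Icc_self (hy.midpt_mem hj)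
  have hslope := fun k (hk : k < ny) => hf.abs_fyy_slope_le hx hy hi hk
  have h1 := abs_correction_le hy hHy hN hslope hj
  have h2 := abs_cellMean_sub_le hy hj (hf.dy (x i)) (hf.dyy (x i)) (hf.dyyy (x i))
    (hf.fyyy_le _ (hx.mem_Icc hi.le))
  have h3 := abs_cellMean_sub_le hy hj (hf.dy (x (i + 1))) (hf.dyy (x (i + 1)))
    (hf.dyyy (x (i + 1))) (hf.fyyy_le _ (hx.mem_Icc (Nat.succ_le_of_lt hi)))
  have h4 := abs_midpoint_difference_le (hx.2.2 i hi).le (fun s => hf.dx s (midpt y j))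
    (fun s => hf.dxx s (midpt y j)) (fun s => hf.dxxx s (midpt y j)) (M := N) (fun s hs =>
      hf.fxxx_le _ ⟨(hx.mem_Icc hi.le).1.trans hs.1,
        hs.2.trans (hx.mem_Icc (Nat.succ_le_of_lt hi)).2⟩ _ hm)
  change |f (x (i + 1)) (midpt y j) - f (x i) (midpt y j)
    - hMid x i * fx (midpt x i) (midpt y j)| ≤ N * hMid x i ^ 3 at h4
  rw [correctedMean_diff]
  set D := (fyy (x (i + 1)) (midpt y j) - fyy (x i) (midpt y j)) / hMid x i with hD
  set c := -(hMid y j ^ 2 / 6 * D) + stepSlope y j / 6 * cubeSum y ny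
    (fun k => (fyy (x (i + 1)) (midpt y k) - fyy (x i) (midpt y k)) / hMid x i) with hc
  set A := cellMean y (f (x (i + 1))) j - f (x (i + 1)) (midpt y j)
    - hMid y j ^ 2 / 24 * fyy (x (i + 1)) (midpt y j) with hA
  set A' := cellMean y (f (x i)) j - f (x i) (midpt y j)
    - hMid y j ^ 2 / 24 * fyy (x i) (midpt y j) with hA'
  set F := f (x (i + 1)) (midpt y j) - f (x i) (midpt y j)
    - hMid x i * fx (midpt x i) (midpt y j) with hF
  have e : (cellMean y (f (x (i + 1))) j - cellMean y (f (x i)) j) / hMid x i + c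
      - fx (midpt x i) (midpt y j)
      = (A - A') / hMid x i + F / hMid x i + hMid y j ^ 2 / 24 * D + c := by
    rw [hA, hA', hF, hD]; field_simp; ring
  rw [e]
  have h5 : |(A - A') / hMid x i| ≤ 2 / C0 * H ^ 2 * N := by
    rw [abs_div, abs_of_pos hpx, div_le_iff₀ hpx]
    have : N * hMid y j ^ 3 ≤ N * H ^ 3 := by gcongr
    calc |A - A'| ≤ |A| + |A'| := abs_sub _ _
      _ ≤ 2 / C0 * H ^ 2 * N * (C0 * H) := by
        rw [show 2 / C0 * H ^ 2 * N * (C0 * H) = 2 * (N * H ^ 3) by field_simp]; linarith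
      _ ≤ _ := by gcongr
  have h6 : |F / hMid x i| ≤ H ^ 2 * N := by
    rw [abs_div, abs_of_pos hpx, div_le_iff₀ hpx]
    calc |F| ≤ N * hMid x i ^ 3 := h4
      _ = hMid x i ^ 2 * N * hMid x i := by ring
      _ ≤ _ := by gcongr
  have h7 : |hMid y j ^ 2 / 24 * D| ≤ H ^ 2 / 24 * N := by
    rw [abs_mul, abs_of_nonneg (by positivity)]
    have := hslope j hj
    gcongr
  have h8 := abs_add_le ((A - A') / hMid x i + F / hMid x i + hMid y j ^ 2 / 24 * D) c
  have h9 := abs_add_three ((A - A') / hMid x i) (F / hMid x i) (hMid y j ^ 2 / 24 * D)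
  have : 0 ≤ H ^ 2 * N := by positivity
  linarith

lemma abs_DyE_correctedMean_sub_le
    (hf : IsDisplacementJet f fx fxx fxxx fy fyy fyyy fyyx g N Nd)
    (hx : IsGrid x nx) (hy : IsGrid y ny) (hny : 1 ≤ ny)
    (hHy : ∀ j < ny, hMid y j ≤ H) (hCy : ∀ j < ny, C0 * H ≤ hMid y j) (hC0 : 0 < C0)
    (hH : 0 < H) (hN : 0 ≤ N) {i j : ℕ} (hi : i ≤ nx) (hj : j ≤ ny) :
    |DyE y ny (correctedMean x y ny f fyy) (fun _ => 0) (fun _ => 0) i j - fy (x i) (y j)|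
      ≤ 8 / C0 * H ^ 2 * N := by
  have hxi := hx.mem_Icc hi
  set S := cubeSum y ny (fun k => fyy (x i) (midpt y k)) with hS
  have hSle : |S| ≤ H ^ 2 * N := abs_cubeSum_le hy hHy (fun k hk => hf.fyy_le _ hxi _
    (Set.Ioo_subset_Icc_self (hy.midpt_mem hk))) le_rfl
  have hend : ∀ j < ny, ∀ c ∈ Set.Icc (y j) (y (j + 1)), |c - midpt y j| = hMid y j / 2 →
      |stepSlope y j - 6 * c * (1 - c)| ≤ 3 * hMid y j →
      |correctedMean x y ny f fyy i j - (f (x i) c + c * (1 - c) * S)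
        - (midpt y j - c) * fy (x i) c| ≤ 2 * N * H ^ 3 := by
    intro j hj c hc hcm hslope
    have hp := (hy.hMid_pos hj).le
    have hjH := hHy j hj
    have hm := Set.Ioo_subset_Icc_self (hy.midpt_mem hj)
    have hc01 : c ∈ Set.Icc (0 : ℝ) 1 := ⟨(hy.mem_Icc hj.le).1.trans hc.1,
      hc.2.trans (hy.mem_Icc (Nat.succ_le_of_lt hj)).2⟩
    have hsub : ∀ t ∈ Set.uIcc c (midpt y j), |fyyy (x i) t| ≤ N := fun t ht =>
      hf.fyyy_le _ hxi _ (Set.uIcc_subset_Icc hc01 hm ht)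
    have h1 := abs_cellMean_sub_le hy hj (hf.dy (x i)) (hf.dyy (x i)) (hf.dyyy (x i))
      (hf.fyyy_le _ hxi)
    have h2 := abs_taylor_two_le (hf.dy (x i)) (hf.dyy (x i)) (hf.dyyy (x i)) hsub
    have h3 := abs_sub_le_of_hasDerivAt (fun t _ => hf.dyyy (x i) t) hsub
    have hsq : (midpt y j - c) ^ 2 = hMid y j ^ 2 / 4 := by
      rw [← sq_abs, abs_sub_comm, hcm]; ring
    rw [abs_sub_comm (midpt y j) c, hcm] at h2 h3
    have h4 : |(stepSlope y j - 6 * c * (1 - c)) / 6 * S| ≤ 3 * H / 6 * (H ^ 2 * N) := by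
      rw [abs_mul, abs_div, abs_of_pos (by norm_num : (0 : ℝ) < 6)]
      have : |stepSlope y j - 6 * c * (1 - c)| ≤ 3 * H := by linarith
      gcongr
    have h5 : |hMid y j ^ 2 / 8 * (fyy (x i) (midpt y j) - fyy (x i) c)|
        ≤ H ^ 2 / 8 * (N * (H / 2)) := by
      rw [abs_mul, abs_of_nonneg (by positivity)]
      have : N * (hMid y j / 2) ≤ N * (H / 2) := by gcongr
      have := h3.trans this
      gcongr
    have h6 : N * hMid y j ^ 3 ≤ N * H ^ 3 := by gcongr
    have h7 : N * (hMid y j / 2) ^ 3 ≤ N * (H / 2) ^ 3 := by gcongr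
    have e : correctedMean x y ny f fyy i j - (f (x i) c + c * (1 - c) * S)
        - (midpt y j - c) * fy (x i) c
        = (cellMean y (f (x i)) j - f (x i) (midpt y j)
            - hMid y j ^ 2 / 24 * fyy (x i) (midpt y j))
          + (f (x i) (midpt y j) - f (x i) c - (midpt y j - c) * fy (x i) c
            - (midpt y j - c) ^ 2 / 2 * fyy (x i) c)
          + (stepSlope y j - 6 * c * (1 - c)) / 6 * S
          - hMid y j ^ 2 / 8 * (fyy (x i) (midpt y j) - fyy (x i) c) := by
      rw [hsq, hS]; unfold correctedMean; ring
    rw [e]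
    refine (abs_sub _ _).trans ?_
    refine (add_le_add_left (abs_add_three _ _ _) _).trans ?_
    have : 0 ≤ N * H ^ 3 := by positivity
    linarith
  have h := abs_DyE_sub_le (C0 := C0) (H := H) hy hny hCy (by positivity) (i := i)
    (v := correctedMean x y ny f fyy) (w := fun j => f (x i) (y j) + y j * (1 - y j) * S)
    (c := fun j => fy (x i) (y j)) (B := 2 * N * H ^ 3)
    (by simp [hy.1, hf.f_bot _ hxi]) (by simp [hy.2.1, hf.f_top _ hxi])
    (fun j hj => by
      have hp := hy.hMid_pos hj
      have h := hend j hj (y j) ⟨le_rfl, (hy.2.2 j hj).le⟩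
        (by rw [show y j - midpt y j = -(hMid y j / 2) by unfold midpt hMid; ring, abs_neg,
          abs_of_pos (by positivity)]) (abs_stepSlope_sub_left_le hy hj)
      rwa [show midpt y j - y j = hMid y j / 2 by unfold midpt hMid; ring] at h)
    (fun j hj => by
      have hp := hy.hMid_pos hj
      have h := hend j hj (y (j + 1)) ⟨(hy.2.2 j hj).le, le_rfl⟩
        (by rw [show y (j + 1) - midpt y j = hMid y j / 2 by unfold midpt hMid; ring,
          abs_of_pos (by positivity)]) (abs_stepSlope_sub_right_le hy hj)
      rwa [show midpt y j - y (j + 1) = -(hMid y j / 2) by unfold midpt hMid; ring, neg_mul,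
        sub_neg_eq_add] at h) hj
  refine h.trans (le_of_eq ?_)
  field_simp
  ring

lemma exists_isInterpolant
    (hf : IsDisplacementJet f fx fxx fxxx fy fyy fyyy fyyx g N Nd)
    (hx : IsGrid x nx) (hy : IsGrid y ny) (hnx : 1 ≤ nx) (hny : 1 ≤ ny)
    (hHx : ∀ i < nx, hMid x i ≤ H) (hHy : ∀ j < ny, hMid y j ≤ H)
    (hCx : ∀ i < nx, C0 * H ≤ hMid x i) (hCy : ∀ j < ny, C0 * H ≤ hMid y j) (hC0 : 0 < C0)
    (hH : 0 < H) (hN : 0 ≤ N) (hNd : 0 ≤ Nd) :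
    ∃ a b, IsInterpolant x y nx ny f fx fy a b ((8 / C0 + 4) * H ^ 2 * N) (2 * H ^ 2 * Nd) := by
  have hmv : ∀ i k, ∃ ξ, i < nx → ξ ∈ Set.Ioo (x i) (x (i + 1)) ∧ fyyx ξ (midpt y k)
      = (fyy (x (i + 1)) (midpt y k) - fyy (x i) (midpt y k)) / hMid x i := by
    intro i k
    by_cases hi : i < nx
    · obtain ⟨ξ, hξ, h⟩ := exists_hasDerivAt_eq_slope (fun s => fyy s (midpt y k))
        (fun s => fyyx s (midpt y k)) (hx.2.2 i hi)
        (continuousOn_of_forall_continuousAt fun s _ => (hf.dyyx s _).continuousAt)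
        fun s _ => hf.dyyx s _
      exact ⟨ξ, fun _ => ⟨hξ, h⟩⟩
    · exact ⟨0, fun h => absurd h hi⟩
  choose ξ hξ using hmv
  have hξ01 : ∀ i < nx, ∀ k, ξ i k ∈ Set.Icc (0 : ℝ) 1 := fun i hi k =>
    ⟨(hx.mem_Icc hi.le).1.trans (hξ i k hi).1.1.le,
      (hξ i k hi).1.2.le.trans (hx.mem_Icc (Nat.succ_le_of_lt hi)).2⟩
  have hm : ∀ k < ny, midpt y k ∈ Set.Icc (0 : ℝ) 1 := fun k hk =>
    Set.Ioo_subset_Icc_self (hy.midpt_mem hk)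
  set q : ℕ → ℕ → ℝ := fun i k => -g (ξ i k) (midpt y k) with hq
  have hqN : ∀ i < nx, ∀ k < ny, |q i k| ≤ N := fun i hi k hk => by
    rw [hq, abs_neg]; exact hf.g_le _ (hξ01 i hi k) _ (hm k hk)
  have hHN : 0 ≤ H ^ 2 * N := by positivity
  have hHNC : 0 ≤ 8 / C0 * (H ^ 2 * N) := by positivity
  refine ⟨correctedMean x y ny f fyy, fun i j => cubePrimitive y ny (q i) j, ?_⟩
  constructor
  · exact fun j hj => ⟨correctedMean_zero hy hj (by rw [hx.1]; exact hf.f_left)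
      (by rw [hx.1]; exact hf.fyy_left), correctedMean_zero hy hj (by rw [hx.2.1]; exact hf.f_right)
      (by rw [hx.2.1]; exact hf.fyy_right)⟩
  · exact fun i _ => ⟨cubePrimitive_zero hy _, cubePrimitive_last hy _⟩
  · exact fun i hi j hj => (abs_correctedMean_sub_le hf hx hy hHy hN hi hj).trans (by linarith)
  · exact fun i hi j hj => (abs_cubePrimitive_le hy hHy hN (hqN i hi) hj).trans (by linarith)
  · refine fun i hi j hj => (abs_correctedMean_diff_sub_le hf hx hy hHx hHy hCx hC0 hH hN
      hi hj).trans ?_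
    have : 2 / C0 ≤ 8 / C0 := by gcongr; norm_num
    gcongr
  · intro i hi j hj
    rw [cubePrimitive_diff hy _ hj]
    have h := abs_correction_le hy hHy hN (hqN i hi) hj
    rw [← abs_neg] at h
    calc _ = _ := by congr 1; ring
      _ ≤ _ := h
      _ ≤ _ := by linarith
  · intro i hi j hj
    rw [cubePrimitive_diff hy _ hj, correctedMean_diff, hf.cellMean_sub]
    have h := abs_correction_le (N := Nd) hy hHy hNd (r := fun k =>
      (fyy (x (i + 1)) (midpt y k) - fyy (x i) (midpt y k)) / hMid x i - q i k)
      (fun k hk => by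
        rw [← (hξ i k hi).2, hq, sub_neg_eq_add]
        exact hf.div_le _ (hξ01 i hi k) _ (hm k hk)) hj
    rw [cubeSum_sub] at h
    calc _ = _ := by congr 1; ring
      _ ≤ _ := h
  · exact fun i hi j hj => (abs_DyE_correctedMean_sub_le hf hx hy hny hHy hCy hC0 hH hN hi hj).trans
      (by linarith)
  · intro i hi j hj
    have hside : ∀ i < nx, ∀ s ∈ Set.Icc (x i) (x (i + 1)),
        |cubePrimitive y ny (q i) j - cubePrimitive y ny (fun k => -g s (midpt y k)) j|
          ≤ H ^ 3 * N := by
      intro i hi s hs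
      have hs01 : s ∈ Set.Icc (0 : ℝ) 1 := ⟨(hx.mem_Icc hi.le).1.trans hs.1,
        hs.2.trans (hx.mem_Icc (Nat.succ_le_of_lt hi)).2⟩
      rw [← cubePrimitive_sub]
      refine (abs_cubePrimitive_le (N := N * H) hy hHy (by positivity) (fun k hk => ?_) hj).trans
        (le_of_eq (by ring))
      rw [show q i k - -g s (midpt y k) = g s (midpt y k) - g (ξ i k) (midpt y k) by
        rw [hq]; ring]
      refine (hf.g_lip _ hs01 _ (hξ01 i hi k) _ (hm k hk)).trans ?_
      have h1 := (hξ i k hi).1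
      have h2 := hHx i hi
      unfold hMid at h2
      have : |s - ξ i k| ≤ H := abs_le.2 ⟨by linarith [hs.1, h1.2], by linarith [hs.2, h1.1]⟩
      gcongr
    have h := abs_DyE_sub_le (C0 := C0) (H := H) hx hnx hCx (by positivity) (i := j)
      (v := fun j i => cubePrimitive y ny (q i) j)
      (w := fun i => cubePrimitive y ny (fun k => -g (x i) (midpt y k)) j)
      (c := fun _ => 0) (B := H ^ 3 * N)
      (cubePrimitive_eq_zero hj fun k hk => by rw [hx.1, hf.g_left _ (hy.midpt_mem hk), neg_zero])
      (cubePrimitive_eq_zero hj fun k hk => by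
        rw [hx.2.1, hf.g_right _ (hy.midpt_mem hk), neg_zero])
      (fun i hi => by simpa using hside i hi (x i) ⟨le_rfl, (hx.2.2 i hi).le⟩)
      (fun i hi => by simpa using hside i hi (x (i + 1)) ⟨(hx.2.2 i hi).le, le_rfl⟩) hi
    rw [sub_zero] at h
    refine h.trans ?_
    rw [show 4 * (H ^ 3 * N) / (C0 * H) = 4 / C0 * (H ^ 2 * N) by field_simp]
    have : 4 / C0 ≤ 8 / C0 + 4 := by
      have : 4 / C0 ≤ 8 / C0 := by gcongr; norm_num
      linarith
    rw [mul_assoc]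
    gcongr

end Construction

section CellDivergence

variable {x y : ℕ → ℝ} {nx ny n : ℕ} {H N : ℝ}

lemma abs_cellMean_le {v : ℝ → ℝ} (hy : IsGrid y n) {j : ℕ} (hj : j < n) {c : ℝ}
    (hv : ∀ t ∈ Set.Icc (0 : ℝ) 1, |v t| ≤ c) : |cellMean y v j| ≤ c := by
  have hp := hy.hMid_pos hj
  have h := intervalIntegral.norm_integral_le_of_norm_le_const (a := y j) (b := y (j + 1))
    (f := v) (C := c) fun t ht => by
      rw [Set.uIoc_of_le (hy.2.2 j hj).le] at ht
      exact hv t ⟨(hy.mem_Icc hj.le).1.trans ht.1.le,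
        ht.2.trans (hy.mem_Icc (Nat.succ_le_of_lt hj)).2⟩
  unfold cellMean
  rw [abs_div, abs_of_pos hp, div_le_iff₀ hp]
  rwa [show y (j + 1) - y j = hMid y j from rfl, abs_of_pos hp] at h

/-- The average over a cell of the divergence of `(u, v)`, written with boundary fluxes, is a
second-order approximation of the divergence at the cell center. -/
lemma abs_cellMean_flux_sub_le {u ux v vy d₁ d₁₁ d₂ d₂₂ : ℝ → ℝ → ℝ}
    (hx : IsGrid x nx) (hy : IsGrid y ny) (hHx : ∀ i < nx, hMid x i ≤ H)
    (hHy : ∀ j < ny, hMid y j ≤ H) (hN : 0 ≤ N)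
    (hu : ∀ s t, HasDerivAt (fun s => u s t) (ux s t) s)
    (hv : ∀ s t, HasDerivAt (fun t => v s t) (vy s t) t)
    (huc : Continuous fun p : ℝ × ℝ => ux p.1 p.2) (hvc : Continuous fun p : ℝ × ℝ => vy p.1 p.2)
    (hd₁ : ∀ s t, HasDerivAt (fun s => ux s t + vy s t) (d₁ s t) s)
    (hd₁₁ : ∀ s t, HasDerivAt (fun s => d₁ s t) (d₁₁ s t) s)
    (hd₂ : ∀ s t, HasDerivAt (fun t => ux s t + vy s t) (d₂ s t) t)
    (hd₂₂ : ∀ s t, HasDerivAt (fun t => d₂ s t) (d₂₂ s t) t)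
    (hd₁₁N : ∀ s ∈ Set.Icc (0 : ℝ) 1, ∀ t ∈ Set.Icc (0 : ℝ) 1, |d₁₁ s t| ≤ N)
    (hd₂₂N : ∀ s ∈ Set.Icc (0 : ℝ) 1, ∀ t ∈ Set.Icc (0 : ℝ) 1, |d₂₂ s t| ≤ N)
    {i j : ℕ} (hi : i < nx) (hj : j < ny) :
    |cellMean y (fun t => u (x (i + 1)) t - u (x i) t) j / hMid x i
      + cellMean x (fun s => v s (y (j + 1)) - v s (y j)) i / hMid y j
      - (ux (midpt x i) (midpt y j) + vy (midpt x i) (midpt y j))| ≤ 2 * H ^ 2 * N := by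
  have hpx := hx.hMid_pos hi
  have hpy := hy.hMid_pos hj
  have hus : ∀ t, Continuous fun s => ux s t := fun t =>
    huc.comp (continuous_id.prodMk continuous_const)
  have hvt : ∀ s, Continuous fun t => vy s t := fun s =>
    hvc.comp (continuous_const.prodMk continuous_id)
  have hvs : ∀ t, Continuous fun s => vy s t := fun t =>
    hvc.comp (continuous_id.prodMk continuous_const)
  have hmx := Set.Ioo_subset_Icc_self (hx.midpt_mem hi)
  have hIu : Continuous fun t => ∫ s in x i..x (i + 1), ux s t :=
    intervalIntegral.continuous_parametric_intervalIntegral_of_continuous'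
      (f := fun t s => ux s t) (huc.comp continuous_swap) _ _
  have hIv : Continuous fun t => ∫ s in x i..x (i + 1), vy s t :=
    intervalIntegral.continuous_parametric_intervalIntegral_of_continuous'
      (f := fun t s => vy s t) (hvc.comp continuous_swap) _ _
  have eu : ∀ t, u (x (i + 1)) t - u (x i) t = ∫ s in x i..x (i + 1), ux s t := fun t =>
    (intervalIntegral.integral_eq_sub_of_hasDerivAt (fun s _ => hu s t)
      ((hus t).intervalIntegrable _ _)).symm
  have ev : ∀ s, v s (y (j + 1)) - v s (y j) = ∫ t in y j..y (j + 1), vy s t := fun s =>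
    (intervalIntegral.integral_eq_sub_of_hasDerivAt (fun t _ => hv s t)
      ((hvt s).intervalIntegrable _ _)).symm
  have hswap : ∫ s in x i..x (i + 1), ∫ t in y j..y (j + 1), vy s t
      = ∫ t in y j..y (j + 1), ∫ s in x i..x (i + 1), vy s t := by
    refine MeasureTheory.intervalIntegral_intervalIntegral_swap ?_
    exact ((hvc.continuousOn (s := Set.uIcc (x i) (x (i + 1)) ×ˢ Set.uIcc (y j) (y (j + 1)))
      ).integrableOn_compact (isCompact_uIcc.prod isCompact_uIcc)).mono_set
      (Set.prod_mono Set.uIoc_subset_uIcc Set.uIoc_subset_uIcc)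
  set w : ℝ → ℝ := fun t => cellMean x (fun s => ux s t + vy s t) i with hw
  have hwc : Continuous w := by
    have : w = fun t => ((∫ s in x i..x (i + 1), ux s t) + ∫ s in x i..x (i + 1), vy s t)
        / hMid x i := by
      funext t
      simp only [hw, cellMean]
      rw [intervalIntegral.integral_add ((hus t).intervalIntegrable _ _)
        ((hvs t).intervalIntegrable _ _)]
    rw [this]
    exact (hIu.add hIv).div_const _
  have e : cellMean y (fun t => u (x (i + 1)) t - u (x i) t) j / hMid x i
      + cellMean x (fun s => v s (y (j + 1)) - v s (y j)) i / hMid y j = cellMean y w j := by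
    simp only [hw, eu, ev]
    unfold cellMean
    rw [hswap, intervalIntegral.integral_div]
    simp only [intervalIntegral.integral_add ((hus _).intervalIntegrable _ _)
        ((hvs _).intervalIntegrable _ _)]
    rw [intervalIntegral.integral_add (hIu.intervalIntegrable _ _) (hIv.intervalIntegrable _ _)]
    field_simp
  have hdc : Continuous fun t => ux (midpt x i) t + vy (midpt x i) t :=
    continuous_iff_continuousAt.2 fun t => (hd₂ _ t).continuousAt
  have h1 : |cellMean y (fun t => w t - (ux (midpt x i) t + vy (midpt x i) t)) j|
      ≤ N * H ^ 2 := by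
    refine abs_cellMean_le hy hj fun t ht => ?_
    refine (abs_cellMean_sub_midpt_le hx hi (hd₁ · t) (hd₁₁ · t)
      (fun s hs => hd₁₁N s hs t ht)).trans ?_
    have := hHx i hi
    gcongr
  have h2 := abs_cellMean_sub_midpt_le hy hj (hd₂ (midpt x i)) (hd₂₂ (midpt x i))
    (hd₂₂N _ hmx)
  have h3 : N * hMid y j ^ 2 ≤ N * H ^ 2 := by
    have := hHy j hj
    gcongr
  have h4 : cellMean y (fun t => w t - (ux (midpt x i) t + vy (midpt x i) t)) j
      = cellMean y w j - cellMean y (fun t => ux (midpt x i) t + vy (midpt x i) t) j := by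
    unfold cellMean
    rw [intervalIntegral.integral_sub (hwc.intervalIntegrable _ _)
      (hdc.intervalIntegrable _ _), sub_div]
  rw [e]
  rw [h4] at h1
  rw [abs_le] at *
  constructor <;> linarith

end CellDivergence

section Smoothness

/-- `f` is of class `C^k` and its derivatives of order at most `k` are bounded by `M` on the unit
square. -/
def HasBoundedDerivs (k : ℕ) (f : ℝ × ℝ → ℝ) (M : ℝ) : Prop :=
  ContDiff ℝ k f ∧ ∀ p ∈ Set.Icc ((0 : ℝ), (0 : ℝ)) ((1 : ℝ), (1 : ℝ)), ∀ j ≤ k,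
    ‖iteratedFDeriv ℝ j f p‖ ≤ M

variable {f g : ℝ × ℝ → ℝ} {M M' : ℝ} {k : ℕ}

lemma hasDerivAt_pdx (hf : Differentiable ℝ f) (s t : ℝ) :
    HasDerivAt (fun s => f (s, t)) (pdx f (s, t)) s :=
  ((hf (s, t)).comp s (differentiableAt_id.prodMk (differentiableAt_const t))).hasDerivAt

lemma hasDerivAt_pdy (hf : Differentiable ℝ f) (s t : ℝ) :
    HasDerivAt (fun t => f (s, t)) (pdy f (s, t)) t :=
  ((hf (s, t)).comp t ((differentiableAt_const s).prodMk differentiableAt_id)).hasDerivAt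

lemma pdx_eq_fderiv (hf : Differentiable ℝ f) : pdx f = fun p => fderiv ℝ f p (1, 0) :=
  funext fun p => ((hf p).hasFDerivAt.comp_hasDerivAt p.1
    ((hasDerivAt_id p.1).prodMk (hasDerivAt_const p.1 p.2))).deriv

lemma pdy_eq_fderiv (hf : Differentiable ℝ f) : pdy f = fun p => fderiv ℝ f p (0, 1) :=
  funext fun p => ((hf p).hasFDerivAt.comp_hasDerivAt p.2
    ((hasDerivAt_const p.2 p.1).prodMk (hasDerivAt_id p.2))).deriv

lemma pdx_pdy_comm (hf : ContDiff ℝ 2 f) : pdx (pdy f) = pdy (pdx f) := by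
  have hd := hf.differentiable two_ne_zero
  have hfd : Differentiable ℝ (fderiv ℝ f) :=
    (hf.fderiv_right (m := 1) (by norm_num)).differentiable one_ne_zero
  rw [pdx_eq_fderiv hd, pdy_eq_fderiv hd, pdx_eq_fderiv (hfd.clm_apply (differentiable_const _)),
    pdy_eq_fderiv (hfd.clm_apply (differentiable_const _))]
  funext p
  have hs := hf.contDiffAt.isSymmSndFDerivAt (x := p) (by simp)
  have h : ∀ v, fderiv ℝ (fun q => fderiv ℝ f q v) p
      = (ContinuousLinearMap.apply ℝ ℝ v).comp (fderiv ℝ (fderiv ℝ f) p) := fun v =>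
    ((ContinuousLinearMap.apply ℝ ℝ v).hasFDerivAt.comp p (hfd p).hasFDerivAt).fderiv
  rw [h, h]
  exact hs _ _

lemma pdy_eq_zero {s : ℝ} (h : ∀ t ∈ Set.Ioo (0 : ℝ) 1, f (s, t) = 0) :
    ∀ t ∈ Set.Ioo (0 : ℝ) 1, pdy f (s, t) = 0 := fun t ht => by
  have : (fun t => f (s, t)) =ᶠ[nhds t] fun _ => 0 :=
    Filter.eventually_of_mem (Ioo_mem_nhds ht.1 ht.2) h
  change deriv (fun t => f (s, t)) t = 0
  rw [this.deriv_eq, deriv_const]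

namespace HasBoundedDerivs

lemma mono (hf : HasBoundedDerivs k f M) (h : M ≤ M') : HasBoundedDerivs k f M' :=
  ⟨hf.1, fun p hp j hj => (hf.2 p hp j hj).trans h⟩

lemma abs_le (hf : HasBoundedDerivs k f M) {s t : ℝ} (hs : s ∈ Set.Icc (0 : ℝ) 1)
    (ht : t ∈ Set.Icc (0 : ℝ) 1) : |f (s, t)| ≤ M := by
  have h := hf.2 (s, t) ⟨⟨hs.1, ht.1⟩, ⟨hs.2, ht.2⟩⟩ 0 (Nat.zero_le _)
  rwa [norm_iteratedFDeriv_zero] at h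

lemma differentiable (hf : HasBoundedDerivs (k + 1) f M) : Differentiable ℝ f :=
  hf.1.differentiable (by simp)

lemma hasDerivAt_pdx (hf : HasBoundedDerivs (k + 1) f M) (s t : ℝ) :
    HasDerivAt (fun s => f (s, t)) (pdx f (s, t)) s :=
  _root_.hasDerivAt_pdx hf.differentiable s t

lemma hasDerivAt_pdy (hf : HasBoundedDerivs (k + 1) f M) (s t : ℝ) :
    HasDerivAt (fun t => f (s, t)) (pdy f (s, t)) t :=
  _root_.hasDerivAt_pdy hf.differentiable s t

lemma fderiv_apply (hf : HasBoundedDerivs (k + 1) f M) {v : ℝ × ℝ} (hv : ‖v‖ ≤ 1) :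
    HasBoundedDerivs k (fun p => fderiv ℝ f p v) M := by
  have hc : ContDiff ℝ k (fderiv ℝ f) := hf.1.fderiv_right (by norm_cast)
  refine ⟨hc.clm_apply contDiff_const, fun p hp j hj => ?_⟩
  refine (norm_iteratedFDeriv_clm_apply_const hc.contDiffAt (by exact_mod_cast hj)).trans ?_
  rw [norm_iteratedFDeriv_fderiv]
  exact (mul_le_of_le_one_left (norm_nonneg _) hv).trans (hf.2 p hp _ (by omega))

lemma pdx (hf : HasBoundedDerivs (k + 1) f M) : HasBoundedDerivs k (pdx f) M := by
  rw [pdx_eq_fderiv hf.differentiable]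
  exact hf.fderiv_apply (by simp [Prod.norm_def])

lemma pdy (hf : HasBoundedDerivs (k + 1) f M) : HasBoundedDerivs k (pdy f) M := by
  rw [pdy_eq_fderiv hf.differentiable]
  exact hf.fderiv_apply (by simp [Prod.norm_def])

lemma add (hf : HasBoundedDerivs k f M) (hg : HasBoundedDerivs k g M') :
    HasBoundedDerivs k (fun p => f p + g p) (M + M') := by
  refine ⟨hf.1.add hg.1, fun p hp j hj => ?_⟩
  have hj' : ((j : ℕ∞) : WithTop ℕ∞) ≤ k := by exact_mod_cast hj
  rw [fun_iteratedFDeriv_add_apply (hf.1.of_le hj').contDiffAt (hg.1.of_le hj').contDiffAt]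
  exact (norm_add_le _ _).trans (add_le_add (hf.2 p hp j hj) (hg.2 p hp j hj))

lemma const_mul (hf : HasBoundedDerivs k f M) (c : ℝ) :
    HasBoundedDerivs k (fun p => c * f p) (|c| * M) := by
  refine ⟨contDiff_const.mul hf.1, fun p hp j hj => ?_⟩
  have hj' : ((j : ℕ∞) : WithTop ℕ∞) ≤ k := by exact_mod_cast hj
  rw [show (fun p => c * f p) = c • f from rfl,
    iteratedFDeriv_const_smul_apply (hf.1.of_le hj').contDiffAt, norm_smul, Real.norm_eq_abs]
  exact mul_le_mul_of_nonneg_left (hf.2 p hp j hj) (abs_nonneg c)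

lemma swap (hf : HasBoundedDerivs k f M) : HasBoundedDerivs k (fun p => f p.swap) M := by
  refine ⟨hf.1.comp (contDiff_snd.prodMk contDiff_fst), fun p hp j hj => ?_⟩
  have h := (LinearIsometryEquiv.prodComm ℝ ℝ ℝ).norm_iteratedFDeriv_comp_right f p j
  exact h.trans_le (hf.2 p.swap ⟨⟨hp.1.2, hp.1.1⟩, ⟨hp.2.2, hp.2.1⟩⟩ j hj)

end HasBoundedDerivs

lemma hasBoundedDerivs_norm3 (hf : ContDiff ℝ 3 f) : HasBoundedDerivs 3 f (norm3 f) := by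
  refine ⟨hf, fun p hp j hj => ?_⟩
  have hb : ∀ k : Fin 4, ∃ B, ∀ p ∈ Set.Icc ((0 : ℝ), (0 : ℝ)) ((1 : ℝ), (1 : ℝ)),
      ‖iteratedFDeriv ℝ (k : ℕ) f p‖ ≤ B := fun k => by
    have hc := hf.continuous_iteratedFDeriv (m := k) (by exact_mod_cast Nat.le_of_lt_succ k.2)
    exact isCompact_Icc.exists_bound_of_continuousOn hc.continuousOn
  choose B hB using hb
  have h1 : ‖iteratedFDeriv ℝ j f p‖ ≤ ⨆ k : Fin 4, ‖iteratedFDeriv ℝ (k : ℕ) f p‖ :=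
    le_ciSup (f := fun k : Fin 4 => ‖iteratedFDeriv ℝ (k : ℕ) f p‖)
      (Set.finite_range _).bddAbove ⟨j, by omega⟩
  refine h1.trans (le_ciSup (f := fun p : Set.Icc ((0 : ℝ), (0 : ℝ)) ((1 : ℝ), (1 : ℝ)) =>
    ⨆ k : Fin 4, ‖iteratedFDeriv ℝ (k : ℕ) f (p : ℝ × ℝ)‖) ⟨∑ k, |B k|, ?_⟩ ⟨p, hp⟩)
  rintro _ ⟨q, rfl⟩
  exact ciSup_le fun k => (hB k q q.2).trans ((le_abs_self _).trans
    (single_le_sum (f := fun k => |B k|) (fun _ _ => abs_nonneg _) (mem_univ k)))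

/-- A displacement field with bounded divergence derivatives provides a jet for its first
component. -/
lemma isDisplacementJet {u v : ℝ × ℝ → ℝ} {N Nd : ℝ} (hu : HasBoundedDerivs 3 u N)
    (hux : HasBoundedDerivs 2 (pdx u) N) (hvy : HasBoundedDerivs 3 (pdy v) N)
    (hdiv : HasBoundedDerivs 2 (fun p => pdx u p + pdy v p) Nd)
    (hbd : ∀ p : ℝ × ℝ, p ∈ Set.Icc ((0 : ℝ), (0 : ℝ)) ((1 : ℝ), (1 : ℝ)) →
      (p.1 = 0 ∨ p.1 = 1 ∨ p.2 = 0 ∨ p.2 = 1) → u p = 0 ∧ v p = 0) :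
    IsDisplacementJet (fun s t => u (s, t)) (fun s t => pdx u (s, t))
      (fun s t => pdx (pdx u) (s, t)) (fun s t => pdx (pdx (pdx u)) (s, t))
      (fun s t => pdy u (s, t)) (fun s t => pdy (pdy u) (s, t))
      (fun s t => pdy (pdy (pdy u)) (s, t)) (fun s t => pdx (pdy (pdy u)) (s, t))
      (fun s t => pdy (pdy (pdy v)) (s, t)) N Nd := by
  have hleft : ∀ t ∈ Set.Icc (0 : ℝ) 1, u (0, t) = 0 ∧ v (0, t) = 0 := fun t ht =>
    hbd (0, t) ⟨⟨le_rfl, ht.1⟩, ⟨zero_le_one, ht.2⟩⟩ (by simp)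
  have hright : ∀ t ∈ Set.Icc (0 : ℝ) 1, u (1, t) = 0 ∧ v (1, t) = 0 := fun t ht =>
    hbd (1, t) ⟨⟨zero_le_one, ht.1⟩, ⟨le_rfl, ht.2⟩⟩ (by simp)
  have hbot : ∀ s ∈ Set.Icc (0 : ℝ) 1, u (s, 0) = 0 := fun s hs =>
    (hbd (s, 0) ⟨⟨hs.1, le_rfl⟩, ⟨hs.2, zero_le_one⟩⟩ (by simp)).1
  have htop : ∀ s ∈ Set.Icc (0 : ℝ) 1, u (s, 1) = 0 := fun s hs =>
    (hbd (s, 1) ⟨⟨hs.1, zero_le_one⟩, ⟨hs.2, le_rfl⟩⟩ (by simp)).1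
  have hsub := Set.Ioo_subset_Icc_self (a := (0 : ℝ)) (b := 1)
  have hgx := hvy.pdy.pdy
  refine ⟨hu.hasDerivAt_pdx, hu.pdx.hasDerivAt_pdx, hu.pdx.pdx.hasDerivAt_pdx,
    hu.hasDerivAt_pdy, hu.pdy.hasDerivAt_pdy, hu.pdy.pdy.hasDerivAt_pdy,
    hu.pdy.pdy.hasDerivAt_pdx, fun s hs t ht => hu.pdx.pdx.pdx.abs_le hs ht,
    fun s hs t ht => hu.pdy.pdy.abs_le hs ht, fun s hs t ht => hu.pdy.pdy.pdy.abs_le hs ht,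
    fun s hs t ht => hu.pdy.pdy.pdx.abs_le hs ht, fun s hs t ht => hvy.pdy.pdy.abs_le hs ht,
    fun s hs s' hs' t ht => ?_, fun s hs t ht => ?_, fun t ht => (hleft t ht).1,
    fun t ht => (hright t ht).1, hbot, htop, ?_, ?_, ?_, ?_⟩
  · exact abs_sub_le_of_hasDerivAt (fun r _ => hgx.hasDerivAt_pdx r t)
      fun r hr => hgx.pdx.abs_le (Set.uIcc_subset_Icc hs' hs hr) ht
  · have h1 : pdx (pdy (pdy u)) = pdy (pdy (pdx u)) := by
      rw [pdx_pdy_comm hu.pdy.1, pdx_pdy_comm (hu.1.of_le (by norm_num))]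
    have h2 : pdy (fun p => pdx u p + pdy v p) = fun p => pdy (pdx u) p + pdy (pdy v) p :=
      funext fun p => ((hux.hasDerivAt_pdy p.1 p.2).add (hvy.hasDerivAt_pdy p.1 p.2)).deriv
    have h3 : pdy (pdy fun p => pdx u p + pdy v p)
        = fun p => pdy (pdy (pdx u)) p + pdy (pdy (pdy v)) p := by
      rw [h2]
      exact funext fun p =>
        ((hux.pdy.hasDerivAt_pdy p.1 p.2).add (hvy.pdy.hasDerivAt_pdy p.1 p.2)).deriv
    have h4 := hdiv.pdy.pdy.abs_le hs ht
    rw [h3] at h4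
    rwa [h1]
  · exact pdy_eq_zero (pdy_eq_zero fun t ht => (hleft t (hsub ht)).1)
  · exact pdy_eq_zero (pdy_eq_zero fun t ht => (hright t (hsub ht)).1)
  · exact pdy_eq_zero (pdy_eq_zero (pdy_eq_zero fun t ht => (hleft t (hsub ht)).2))
  · exact pdy_eq_zero (pdy_eq_zero (pdy_eq_zero fun t ht => (hright t (hsub ht)).2))

end Smoothness

section Consistency

variable {x y : ℕ → ℝ} {nx ny n : ℕ} {H C0 M N Nd : ℝ} {u v s11 s22 s12 : ℝ × ℝ → ℝ}

lemma DyE_add (v w : ℕ → ℕ → ℝ) (i j : ℕ) :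
    DyE y n (fun i j => v i j + w i j) (fun _ => 0) (fun _ => 0) i j
      = DyE y n v (fun _ => 0) (fun _ => 0) i j + DyE y n w (fun _ => 0) (fun _ => 0) i j := by
  unfold DyE
  split_ifs <;> ring

lemma DyE_sub (v w : ℕ → ℕ → ℝ) (i j : ℕ) :
    DyE y n (fun i j => v i j - w i j) (fun _ => 0) (fun _ => 0) i j
      = DyE y n v (fun _ => 0) (fun _ => 0) i j - DyE y n w (fun _ => 0) (fun _ => 0) i j := by
  unfold DyE
  split_ifs <;> ring

lemma DxE_add (v w : ℕ → ℕ → ℝ) (i j : ℕ) :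
    DxE x n (fun i j => v i j + w i j) (fun _ => 0) (fun _ => 0) i j
      = DxE x n v (fun _ => 0) (fun _ => 0) i j + DxE x n w (fun _ => 0) (fun _ => 0) i j :=
  DyE_add (fun j i => v i j) (fun j i => w i j) j i

lemma DxE_sub (v w : ℕ → ℕ → ℝ) (i j : ℕ) :
    DxE x n (fun i j => v i j - w i j) (fun _ => 0) (fun _ => 0) i j
      = DxE x n v (fun _ => 0) (fun _ => 0) i j - DxE x n w (fun _ => 0) (fun _ => 0) i j :=
  DyE_sub (fun j i => v i j) (fun j i => w i j) j i

/-- A discrete displacement field vanishing on the boundary that is consistent with `(u, v)` to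
second order, the error of its divergence being controlled by `Nd` only. -/
lemma exists_displacement_interpolant (hx : IsGrid x nx) (hy : IsGrid y ny)
    (hnx : 1 ≤ nx) (hny : 1 ≤ ny) (hHx : ∀ i < nx, hMid x i ≤ H) (hHy : ∀ j < ny, hMid y j ≤ H)
    (hCx : ∀ i < nx, C0 * H ≤ hMid x i) (hCy : ∀ j < ny, C0 * H ≤ hMid y j) (hC0 : 0 < C0)
    (hH : 0 < H) (hN : 0 ≤ N) (hNd : 0 ≤ Nd)
    (hu : HasBoundedDerivs 3 u N) (hv : HasBoundedDerivs 3 v N)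
    (hux : HasBoundedDerivs 3 (pdx u) N) (hvy : HasBoundedDerivs 3 (pdy v) N)
    (hdiv : HasBoundedDerivs 2 (fun p => pdx u p + pdy v p) Nd)
    (hbd : ∀ p : ℝ × ℝ, p ∈ Set.Icc ((0 : ℝ), (0 : ℝ)) ((1 : ℝ), (1 : ℝ)) →
      (p.1 = 0 ∨ p.1 = 1 ∨ p.2 = 0 ∨ p.2 = 1) → u p = 0 ∧ v p = 0) :
    ∃ U V : ℕ → ℕ → ℝ, (∀ j < ny, U 0 j = 0 ∧ U nx j = 0) ∧ (∀ i < nx, V i 0 = 0 ∧ V i ny = 0) ∧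
      (∀ i ≤ nx, ∀ j < ny, |U i j - u (x i, midpt y j)| ≤ 2 * ((8 / C0 + 4) * H ^ 2 * N)) ∧
      (∀ i < nx, ∀ j ≤ ny, |V i j - v (midpt x i, y j)| ≤ 2 * ((8 / C0 + 4) * H ^ 2 * N)) ∧
      (∀ i < nx, ∀ j < ny,
        |(U (i + 1) j - U i j) / hMid x i - (V i (j + 1) - V i j) / hMid y j
          - (pdx u (midpt x i, midpt y j) - pdy v (midpt x i, midpt y j))|
          ≤ 4 * ((8 / C0 + 4) * H ^ 2 * N)) ∧
      (∀ i < nx, ∀ j < ny,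
        |(U (i + 1) j - U i j) / hMid x i + (V i (j + 1) - V i j) / hMid y j
          - (pdx u (midpt x i, midpt y j) + pdy v (midpt x i, midpt y j))| ≤ 6 * H ^ 2 * Nd) ∧
      ∀ i ≤ nx, ∀ j ≤ ny,
        |DyE y ny U (fun _ => 0) (fun _ => 0) i j + DxE x nx V (fun _ => 0) (fun _ => 0) i j
          - (pdy u (x i, y j) + pdx v (x i, y j))| ≤ 4 * ((8 / C0 + 4) * H ^ 2 * N) := by
  have hle : HasBoundedDerivs 2 (pdx u) N :=
    ⟨hux.1.of_le (by norm_num), fun p hp j hj => hux.2 p hp j (by omega)⟩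
  have hle' : HasBoundedDerivs 2 (pdy v) N :=
    ⟨hvy.1.of_le (by norm_num), fun p hp j hj => hvy.2 p hp j (by omega)⟩
  have hdiv' : HasBoundedDerivs 2 (fun p => pdy v p.swap + pdx u p.swap) Nd := by
    simp only [add_comm (pdy v _)]
    exact hdiv.swap
  have hj₁ := isDisplacementJet hu hle hvy hdiv hbd
  have hj₂ : IsDisplacementJet (fun s t => v (t, s)) (fun s t => pdy v (t, s)) _ _
      (fun s t => pdx v (t, s)) _ _ _ _ N Nd :=
    isDisplacementJet (u := fun p => v p.swap) (v := fun p => u p.swap) hv.swap hle'.swap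
      hux.swap hdiv' fun p hp hb =>
      (hbd p.swap ⟨⟨hp.1.2, hp.1.1⟩, ⟨hp.2.2, hp.2.1⟩⟩ (by
        rw [Prod.fst_swap, Prod.snd_swap]; tauto)).symm
  obtain ⟨a, b, h₁⟩ := exists_isInterpolant hj₁ hx hy hnx hny hHx hHy hCx hCy hC0 hH hN hNd
  obtain ⟨a', b', h₂⟩ := exists_isInterpolant hj₂ hy hx hny hnx hHy hHx hCy hCx hC0 hH hN hNd
  refine ⟨fun i j => a i j + b' j i, fun i j => b i j + a' j i, fun j hj => ?_, fun i hi => ?_,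
    fun i hi j hj => ?_, fun i hi j hj => ?_, fun i hi j hj => ?_, fun i hi j hj => ?_,
    fun i hi j hj => ?_⟩
  · simp [h₁.a_bdry j hj, h₂.b_bdry j hj]
  · simp [h₁.b_bdry i hi, h₂.a_bdry i hi]
  · have e₁ := h₁.a_sub i hi j hj
    have e₂ := h₂.b_le j hj i hi
    rw [abs_le] at *
    constructor <;> linarith
  · have e₁ := h₂.a_sub j hj i hi
    have e₂ := h₁.b_le i hi j hj
    rw [abs_le] at *
    constructor <;> linarith
  · have e₁ := h₁.dx_a i hi j hj
    have e₂ := h₂.dx_a j hj i hi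
    have e₃ := h₁.dy_b i hi j hj
    have e₄ := h₂.dy_b j hj i hi
    simp only [add_sub_add_comm (a _ _), add_sub_add_comm (b _ _), add_div]
    rw [abs_le] at *
    constructor <;> linarith
  · have e₁ := h₁.div i hi j hj
    have e₂ := h₂.div j hj i hi
    have e₃ := abs_cellMean_flux_sub_le (u := fun s t => u (s, t)) (v := fun s t => v (s, t))
      (d₁ := fun s t => pdx (fun p => pdx u p + pdy v p) (s, t))
      (d₂ := fun s t => pdy (fun p => pdx u p + pdy v p) (s, t)) hx hy hHx hHy hNd
      hu.hasDerivAt_pdx hv.hasDerivAt_pdy hux.1.continuous hvy.1.continuous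
      hdiv.hasDerivAt_pdx hdiv.pdx.hasDerivAt_pdx hdiv.hasDerivAt_pdy hdiv.pdy.hasDerivAt_pdy
      (fun s hs t ht => hdiv.pdx.pdx.abs_le hs ht) (fun s hs t ht => hdiv.pdy.pdy.abs_le hs ht)
      hi hj
    simp only [add_sub_add_comm (a _ _), add_sub_add_comm (b _ _), add_div]
    rw [abs_le] at *
    constructor <;> linarith
  · have e₁ := h₁.dy_a i hi j hj
    have e₂ := h₂.dy_a j hj i hi
    have e₃ := h₁.dx_b i hi j hj
    have e₄ := h₂.dx_b j hj i hi
    rw [DyE_add, DxE_add]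
    change |DxE x nx (fun i j => a' j i) (fun _ => 0) (fun _ => 0) i j - _| ≤ _ at e₂
    change |DyE y ny (fun i j => b' j i) (fun _ => 0) (fun _ => 0) i j| ≤ _ at e₄
    rw [abs_le] at *
    constructor <;> linarith

/-- Values at cell centers, corrected so that their difference quotients are second-order
accurate at the nodes of an arbitrary grid. -/
def correctedStress (x y : ℕ → ℝ) (s : ℝ × ℝ → ℝ) (i j : ℕ) : ℝ :=
  s (midpt x i, midpt y j) - hMid x i ^ 2 / 8 * pdx (pdx s) (midpt x i, midpt y j)

lemma abs_correctedStress_sub_le (hx : IsGrid x nx) (hy : IsGrid y ny)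
    (hHx : ∀ i < nx, hMid x i ≤ H) {s : ℝ × ℝ → ℝ} (hs : HasBoundedDerivs 3 s M)
    {i j : ℕ} (hi : i < nx) (hj : j < ny) :
    |correctedStress x y s i j - s (midpt x i, midpt y j)| ≤ H ^ 2 / 8 * M := by
  have hp := (hx.hMid_pos hi).le
  have h := hs.pdx.pdx.abs_le (Set.Ioo_subset_Icc_self (hx.midpt_mem hi))
    (Set.Ioo_subset_Icc_self (hy.midpt_mem hj))
  rw [correctedStress, sub_sub_cancel_left, abs_neg, abs_mul, abs_of_nonneg (by positivity)]
  have := hHx i hi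
  have := (abs_nonneg _).trans h
  gcongr

lemma abs_momentum_sub_le (hx : IsGrid x nx) (hy : IsGrid y ny)
    (hHx : ∀ i < nx, hMid x i ≤ H) (hHy : ∀ j < ny, hMid y j ≤ H)
    (hCx : ∀ i < nx, C0 * H ≤ hMid x i) (hC0 : 0 < C0) (hH : 0 < H) (hM : 0 ≤ M)
    {s t : ℝ × ℝ → ℝ} (hs : HasBoundedDerivs 3 s M) (ht : HasBoundedDerivs 3 t M)
    {i j : ℕ} (hi₁ : 1 ≤ i) (hi : i < nx) (hj : j < ny) :
    |(correctedStress x y s i j - correctedStress x y s (i - 1) j) / hNode x nx i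
      + (t (x i, y (j + 1)) - t (x i, y j)) / hMid y j
      - (pdx s (x i, midpt y j) + pdy t (x i, midpt y j))| ≤ (1 / C0 + 1) * H ^ 2 * M := by
  obtain ⟨k, rfl⟩ : ∃ k, i = k + 1 := ⟨i - 1, by omega⟩
  have hk : k < nx := by omega
  have hpy := hy.hMid_pos hj
  have hpk := hx.hMid_pos hk
  have hpi := hx.hMid_pos hi
  have hm := Set.Ioo_subset_Icc_self (hy.midpt_mem hj)
  have hn : hNode x nx (k + 1) = midpt x (k + 1) - midpt x k := by
    simp [hNode, hi.ne]
  have hn' : hNode x nx (k + 1) = (hMid x (k + 1) + hMid x k) / 2 := by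
    rw [hn]; unfold midpt hMid; ring
  have hnp : 0 < hNode x nx (k + 1) := by rw [hn']; positivity
  have hhalf : ∀ m < nx, |midpt x m - x (k + 1)| = hMid x m / 2 →
      |correctedStress x y s m j - s (x (k + 1), midpt y j)
        - (midpt x m - x (k + 1)) * pdx s (x (k + 1), midpt y j)| ≤ M * H ^ 3 / 4 := by
    intro m hmx hd
    have hpm := hx.hMid_pos hmx
    have h := abs_corrected_difference_le (a := x (k + 1)) (b := midpt x m) (M := M)
      (fun r => hs.hasDerivAt_pdx r (midpt y j)) (fun r => hs.pdx.hasDerivAt_pdx r (midpt y j))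
      (fun r => hs.pdx.pdx.hasDerivAt_pdx r (midpt y j)) (fun r hr =>
        hs.pdx.pdx.pdx.abs_le (Set.uIcc_subset_Icc (hx.mem_Icc hi.le)
          (Set.Ioo_subset_Icc_self (hx.midpt_mem hmx)) hr) hm)
    have hsq : (midpt x m - x (k + 1)) ^ 2 / 2 = hMid x m ^ 2 / 8 := by
      rw [← sq_abs, hd]; ring
    rw [hsq, hd] at h
    have : M * hMid x m ^ 3 ≤ M * H ^ 3 := by
      have := hHx m hmx
      gcongr
    unfold correctedStress
    linarith
  have h₁ := hhalf (k + 1) hi (by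
    rw [show midpt x (k + 1) - x (k + 1) = hMid x (k + 1) / 2 by unfold midpt hMid; ring,
      abs_of_pos (by positivity)])
  have h₂ := hhalf k hk (by
    rw [show midpt x k - x (k + 1) = -(hMid x k / 2) by unfold midpt hMid; ring, abs_neg,
      abs_of_pos (by positivity)])
  have h₃ := abs_midpoint_difference_le (hy.2.2 j hj).le (ht.hasDerivAt_pdy (x (k + 1)))
    (ht.pdy.hasDerivAt_pdy (x (k + 1))) (ht.pdy.pdy.hasDerivAt_pdy (x (k + 1))) (M := M)
    (fun r hr => ht.pdy.pdy.pdy.abs_le (hx.mem_Icc hi.le) ⟨(hy.mem_Icc hj.le).1.trans hr.1,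
        hr.2.trans (hy.mem_Icc (Nat.succ_le_of_lt hj)).2⟩)
  change |_ - _ - hMid y j * pdy t (x (k + 1), midpt y j)| ≤ M * hMid y j ^ 3 at h₃
  rw [Nat.add_sub_cancel]
  have e₁ : |(correctedStress x y s (k + 1) j - correctedStress x y s k j) / hNode x nx (k + 1)
      - pdx s (x (k + 1), midpt y j)| ≤ 1 / C0 * H ^ 2 * M := by
    rw [div_sub' hnp.ne', abs_div, abs_of_pos hnp, div_le_iff₀ hnp]
    have hlow : C0 * H ≤ hNode x nx (k + 1) := by
      rw [hn']; linarith [hCx k hk, hCx (k + 1) hi]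
    have h0 : 0 ≤ M * H ^ 3 := by positivity
    have : |correctedStress x y s (k + 1) j - correctedStress x y s k j
        - hNode x nx (k + 1) * pdx s (x (k + 1), midpt y j)| ≤ M * H ^ 3 := by
      rw [hn]
      rw [abs_le] at *
      constructor <;> linarith
    refine this.trans ?_
    calc M * H ^ 3 = 1 / C0 * H ^ 2 * M * (C0 * H) := by field_simp
      _ ≤ _ := by gcongr
  have e₂ : |(t (x (k + 1), y (j + 1)) - t (x (k + 1), y j)) / hMid y j
      - pdy t (x (k + 1), midpt y j)| ≤ H ^ 2 * M := by
    rw [div_sub' hpy.ne', abs_div, abs_of_pos hpy, div_le_iff₀ hpy]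
    refine h₃.trans ?_
    have := hHy j hj
    calc M * hMid y j ^ 3 = hMid y j ^ 2 * M * hMid y j := by ring
      _ ≤ _ := by gcongr
  rw [abs_le] at *
  constructor <;> linarith

end Consistency

section Convergence

variable {x y : ℕ → ℝ} {nx ny : ℕ} {H C0 M lam mu : ℝ} {ux uy s11 s22 s12 : ℝ × ℝ → ℝ}
  {Wx Wy Z11 Z22 Z12 : ℕ → ℕ → ℝ} {Wx0 Wxn Wy0 Wyn : ℕ → ℝ}

/-- The truncation error of the MAC-E scheme is at most `truncationConst mu C0 * H ^ 2 * M`. -/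
def truncationConst (mu C0 : ℝ) : ℝ := 4 * (8 / C0 + 4) * (1 + 1 / mu) + 1 / mu + 7 + 1 / C0

lemma truncationConst_pos (hmu : 0 < mu) (hC0 : 0 < C0) : 0 < truncationConst mu C0 := by
  unfold truncationConst
  positivity

/-- The displacement gradient is controlled through the stress, its divergence uniformly in the
incompressible limit. -/
lemma hasBoundedDerivs_gradient (hmu : 0 < mu) (hlam : 0 < lam) (hM : 0 ≤ M)
    (h11 : ∀ p, s11 p = (lam + 2 * mu) * pdx ux p + lam * pdy uy p)
    (h22 : ∀ p, s22 p = lam * pdx ux p + (lam + 2 * mu) * pdy uy p)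
    (hs11 : HasBoundedDerivs 3 s11 M) (hs22 : HasBoundedDerivs 3 s22 M) :
    HasBoundedDerivs 3 (pdx ux) (M / mu) ∧ HasBoundedDerivs 3 (pdy uy) (M / mu) ∧
      HasBoundedDerivs 2 (fun p => pdx ux p + pdy uy p) (M / (lam + mu)) := by
  have hlm : 0 < lam + mu := by positivity
  have hd : ∀ p, 1 / (2 * (lam + mu)) * (s11 p + s22 p) = pdx ux p + pdy uy p := fun p => by
    rw [h11, h22]; field_simp; ring
  have hb : ∀ p, 1 / (2 * mu) * (s11 p + (-1) * s22 p) = pdx ux p - pdy uy p := fun p => by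
    rw [h11, h22]; field_simp; ring
  have hD := (hs11.add hs22).const_mul (1 / (2 * (lam + mu)))
  have hB := (hs11.add (hs22.const_mul (-1))).const_mul (1 / (2 * mu))
  simp only [hd] at hD
  simp only [hb] at hB
  replace hD : HasBoundedDerivs 3 (fun p => pdx ux p + pdy uy p) (M / (lam + mu)) :=
    hD.mono (le_of_eq (by rw [abs_of_pos (by positivity)]; field_simp; ring))
  replace hB : HasBoundedDerivs 3 (fun p => pdx ux p - pdy uy p) (M / mu) :=
    hB.mono (le_of_eq (by
      rw [abs_of_pos (a := 1 / (2 * mu)) (by positivity), abs_neg, abs_one]; field_simp; ring))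
  have hD' : HasBoundedDerivs 3 (fun p => pdx ux p + pdy uy p) (M / mu) :=
    hD.mono (by gcongr; linarith)
  refine ⟨?_, ?_, hD.1.of_le (by norm_num), fun p hp j hj => hD.2 p hp j (by omega)⟩
  · have h := (hD'.add hB).const_mul (1 / 2)
    rw [show (fun p => 1 / 2 * (pdx ux p + pdy uy p + (pdx ux p - pdy uy p))) = pdx ux from
      funext fun p => by ring] at h
    exact h.mono (le_of_eq (by norm_num; ring))
  · have h := (hD'.add (hB.const_mul (-1))).const_mul (1 / 2)
    rw [show (fun p => 1 / 2 * (pdx ux p + pdy uy p + -1 * (pdx ux p - pdy uy p))) = pdy uy from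
      funext fun p => by ring] at h
    exact h.mono (le_of_eq (by norm_num; ring))

lemma DyE_eq_zero_boundary {n i : ℕ} {v : ℕ → ℕ → ℝ} {v0 vn : ℕ → ℝ} (h : v0 i = 0 ∧ vn i = 0)
    (j : ℕ) : DyE y n v v0 vn i j = DyE y n v (fun _ => 0) (fun _ => 0) i j := by
  simp [DyE, h.1, h.2]

lemma DxE_eq_zero_boundary {n j : ℕ} {v : ℕ → ℕ → ℝ} {v0 vn : ℕ → ℝ} (h : v0 j = 0 ∧ vn j = 0)
    (i : ℕ) : DxE x n v v0 vn i j = DxE x n v (fun _ => 0) (fun _ => 0) i j := by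
  simp [DxE, h.1, h.2]

lemma exists_displacement_superclose (hmu : 0 < mu) (hlam : 0 < lam) (hx : IsGrid x nx)
    (hy : IsGrid y ny) (hnx : 1 ≤ nx) (hny : 1 ≤ ny) (hHx : ∀ i < nx, hMid x i ≤ H)
    (hHy : ∀ j < ny, hMid y j ≤ H) (hCx : ∀ i < nx, C0 * H ≤ hMid x i)
    (hCy : ∀ j < ny, C0 * H ≤ hMid y j) (hC0 : 0 < C0) (hH : 0 < H) (hM : 0 ≤ M)
    (hux : HasBoundedDerivs 3 ux M) (huy : HasBoundedDerivs 3 uy M)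
    (hbd : ∀ p : ℝ × ℝ, p ∈ Set.Icc ((0 : ℝ), (0 : ℝ)) ((1 : ℝ), (1 : ℝ)) →
      (p.1 = 0 ∨ p.1 = 1 ∨ p.2 = 0 ∨ p.2 = 1) → ux p = 0 ∧ uy p = 0)
    (h11 : ∀ p, s11 p = (lam + 2 * mu) * pdx ux p + lam * pdy uy p)
    (h22 : ∀ p, s22 p = lam * pdx ux p + (lam + 2 * mu) * pdy uy p)
    (h12 : ∀ p, s12 p = mu * (pdy ux p + pdx uy p))
    (hs11 : HasBoundedDerivs 3 s11 M) (hs22 : HasBoundedDerivs 3 s22 M)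
    (hs12 : HasBoundedDerivs 3 s12 M)
    (hW : MACESol nx ny x y lam mu Wx Wx0 Wxn Wy Wy0 Wyn Z11 Z22 Z12
      (fun i j => pdx s11 (x i, midpt y j) + pdy s12 (x i, midpt y j))
      (fun i j => pdx s12 (midpt x i, y j) + pdy s22 (midpt x i, y j))) :
    ∃ U V : ℕ → ℕ → ℝ,
      (∀ i ≤ nx, ∀ j < ny, |U i j - ux (x i, midpt y j)| ≤ truncationConst mu C0 * H ^ 2 * M) ∧
      (∀ i < nx, ∀ j ≤ ny, |V i j - uy (midpt x i, y j)| ≤ truncationConst mu C0 * H ^ 2 * M) ∧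
      ipTM x y nx ny (fun i j => Wx i j - U i j) (fun i j => Wx i j - U i j)
        + ipMT x y nx ny (fun i j => Wy i j - V i j) (fun i j => Wy i j - V i j)
        ≤ (12 / mu ^ 2 + 5) * (truncationConst mu C0 * H ^ 2 * M) ^ 2 := by
  obtain ⟨hWx, hWx0, hWy, hWy0, hZ11, hZ22, hZ12, hf1, hf2⟩ := hW
  beta_reduce at hf1 hf2
  obtain ⟨hgx, hgy, hdiv⟩ := hasBoundedDerivs_gradient hmu hlam hM h11 h22 hs11 hs22
  have hlm : 0 < lam + mu := by positivity
  have hMN : M ≤ M * (1 + 1 / mu) := le_mul_of_one_le_right hM (by simp [hmu.le])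
  have hMN' : M / mu ≤ M * (1 + 1 / mu) := by
    rw [mul_add, mul_one_div]; linarith
  obtain ⟨U, V, hU, hV, hUu, hVv, hP, hT, hS⟩ := exists_displacement_interpolant hx hy hnx hny
    hHx hHy hCx hCy hC0 hH (hM.trans hMN) (div_nonneg hM hlm.le) (hux.mono hMN) (huy.mono hMN)
    (hgx.mono hMN') (hgy.mono hMN') hdiv hbd
  set q := H ^ 2 * M with hq
  have hq0 : 0 ≤ q := by positivity
  have hε : truncationConst mu C0 * H ^ 2 * M
      = 4 * ((8 / C0 + 4) * H ^ 2 * (M * (1 + 1 / mu))) + q / mu + 7 * q + q / C0 := by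
    rw [truncationConst, hq]; ring
  have hR : 0 ≤ (8 / C0 + 4) * H ^ 2 * (M * (1 + 1 / mu)) := by positivity
  have hqm : 0 ≤ q / mu := by positivity
  have hqC : 0 ≤ q / C0 := by positivity
  have hmom : (1 / C0 + 1) * H ^ 2 * M ≤ truncationConst mu C0 * H ^ 2 * M := by
    rw [hε, show (1 / C0 + 1) * H ^ 2 * M = q / C0 + q by rw [hq]; ring]; linarith
  have hc : ∀ i < nx, ∀ j < ny,
      |correctedStress x y s11 i j - s11 (midpt x i, midpt y j)| ≤ q / 8 ∧
      |correctedStress y x (fun p => s22 p.swap) j i - s22 (midpt x i, midpt y j)| ≤ q / 8 :=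
    fun i hi j hj => ⟨(abs_correctedStress_sub_le hx hy hHx hs11 hi hj).trans_eq (by ring),
      (abs_correctedStress_sub_le hy hx hHy hs22.swap hj hi).trans_eq (by ring)⟩
  refine ⟨U, V, fun i hi j hj => (hUu i hi j hj).trans (by rw [hε]; linarith),
    fun i hi j hj => (hVv i hi j hj).trans (by rw [hε]; linarith), ?_⟩
  refine mac_stability hmu hlam hx hy hnx hny
    (E11 := fun i j => Z11 i j - correctedStress x y s11 i j)
    (E22 := fun i j => Z22 i j - correctedStress y x (fun p => s22 p.swap) j i)
    (E12 := fun i j => Z12 i j - s12 (x i, y j))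
    (fun j hj => by simp [hWx j hj, hU j hj]) (fun i hi => by simp [hWy i hi, hV i hi])
    (fun i hi j hj => ?_) (fun i hi j hj => ?_) (fun i hi j hj => ?_)
    (fun i hi₁ hi j hj => ?_) (fun i hi j hj₁ hj => ?_)
  · obtain ⟨e₁, e₂⟩ := hc i hi j hj
    have e₃ := hP i hi j hj
    have hz : (Z11 i j - Z22 i j) / (2 * mu)
        = (Wx (i + 1) j - Wx i j) / hMid x i - (Wy i (j + 1) - Wy i j) / hMid y j := by
      rw [← hZ11 i hi j hj, ← hZ22 i hi j hj]; ring
    have hs : (s11 (midpt x i, midpt y j) - s22 (midpt x i, midpt y j)) / (2 * mu)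
        = pdx ux (midpt x i, midpt y j) - pdy uy (midpt x i, midpt y j) := by
      rw [h11, h22]; field_simp; ring
    generalize correctedStress x y s11 i j = c₁ at *
    generalize correctedStress y x (fun p => s22 p.swap) j i = c₂ at *
    have e₄ : |((c₁ - s11 (midpt x i, midpt y j)) - (c₂ - s22 (midpt x i, midpt y j))) / (2 * mu)|
        ≤ q / mu := by
      rw [abs_div, abs_of_pos (a := 2 * mu) (by positivity), div_le_div_iff₀ (by positivity) hmu]
      have := abs_sub (c₁ - s11 (midpt x i, midpt y j)) (c₂ - s22 (midpt x i, midpt y j))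
      nlinarith
    rw [hε]
    simp only [sub_sub_sub_comm _ (U _ _), sub_sub_sub_comm _ (V _ _), sub_div _ (U _ _ - _),
      sub_div _ (V _ _ - _), sub_sub_sub_comm _ c₁, sub_div _ (c₁ - c₂), hz] at e₄ ⊢
    rw [sub_sub_sub_comm, sub_div, hs] at e₄
    rw [abs_le] at *
    constructor <;> linarith
  · obtain ⟨e₁, e₂⟩ := hc i hi j hj
    have e₃ := hT i hi j hj
    have hz : (Z11 i j + Z22 i j) / (2 * (lam + mu))
        = (Wx (i + 1) j - Wx i j) / hMid x i + (Wy i (j + 1) - Wy i j) / hMid y j := by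
      rw [← hZ11 i hi j hj, ← hZ22 i hi j hj]; field_simp; ring
    have hs : (s11 (midpt x i, midpt y j) + s22 (midpt x i, midpt y j)) / (2 * (lam + mu))
        = pdx ux (midpt x i, midpt y j) + pdy uy (midpt x i, midpt y j) := by
      rw [h11, h22]; field_simp; ring
    generalize correctedStress x y s11 i j = c₁ at *
    generalize correctedStress y x (fun p => s22 p.swap) j i = c₂ at *
    have e₄ : |((c₁ - s11 (midpt x i, midpt y j)) + (c₂ - s22 (midpt x i, midpt y j)))
        / (2 * (lam + mu))| ≤ q / (lam + mu) := by
      rw [abs_div, abs_of_pos (a := 2 * (lam + mu)) (by positivity),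
        div_le_div_iff₀ (by positivity) hlm]
      have := abs_add_le (c₁ - s11 (midpt x i, midpt y j)) (c₂ - s22 (midpt x i, midpt y j))
      nlinarith
    have e₅ : q / (lam + mu) + 6 * H ^ 2 * (M / (lam + mu))
        ≤ truncationConst mu C0 * H ^ 2 * M / (lam + mu) := by
      rw [show q / (lam + mu) + 6 * H ^ 2 * (M / (lam + mu)) = 7 * q / (lam + mu) by rw [hq]; ring]
      exact div_le_div_of_nonneg_right (by rw [hε]; linarith) hlm.le
    simp only [sub_sub_sub_comm _ (U _ _), sub_sub_sub_comm _ (V _ _), sub_div _ (U _ _ - _),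
      sub_div _ (V _ _ - _), sub_add_sub_comm _ c₁, sub_div _ (c₁ + c₂), hz] at e₄ ⊢
    rw [sub_add_sub_comm, sub_div, hs] at e₄
    rw [abs_le] at *
    constructor <;> linarith
  · have e₃ := hS i hi j hj
    rw [DyE_sub, DxE_sub, hZ12 i hi j hj, h12, DyE_eq_zero_boundary (hWx0 i hi),
      DxE_eq_zero_boundary (hWy0 j hj)]
    refine le_trans (le_of_eq ?_)
      (mul_le_mul_of_nonneg_left (e₃.trans (by rw [hε]; linarith)) hmu.le)
    rw [← abs_of_pos hmu, ← abs_mul, abs_of_pos hmu]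
    congr 1
    ring
  · refine le_trans (le_of_eq ?_)
      ((abs_momentum_sub_le hx hy hHx hHy hCx hC0 hH hM hs11 hs12 hi₁ hi hj).trans hmom)
    rw [← hf1 i hi₁ hi j hj, ← abs_neg]
    congr 1
    ring
  · have e := abs_momentum_sub_le hy hx hHy hHx hCy hC0 hH hM hs22.swap hs12.swap hj₁ hj hi
    refine le_trans (le_of_eq ?_) (e.trans hmom)
    have h : pdx (fun p => s22 p.swap) (y j, midpt x i) + pdy (fun p => s12 p.swap) (y j, midpt x i)
        = pdx s12 (midpt x i, y j) + pdy s22 (midpt x i, y j) := add_comm _ _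
    rw [h, ← hf2 i hi j hj₁ hj, ← abs_neg]
    congr 1
    simp only [Prod.swap_prod_mk]
    ring

lemma ipTM_self_nonneg (hx : IsGrid x nx) (hy : IsGrid y ny) (φ : ℕ → ℕ → ℝ) :
    0 ≤ ipTM x y nx ny φ φ := by
  refine sum_nonneg fun i hi => sum_nonneg fun j hj => ?_
  have hi := mem_Ico.1 hi
  have h₁ := hx.hNode_pos (by omega) hi.2.le
  have h₂ := hy.hMid_pos (mem_range.1 hj)
  rw [mul_assoc]
  exact mul_nonneg (by positivity) (mul_self_nonneg _)

lemma ipTM_le_of_abs_sub_le (hx : IsGrid x nx) (hy : IsGrid y ny) (hnx : 1 ≤ nx)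
    {φ θ : ℕ → ℕ → ℝ} {c : ℝ} (h : ∀ i ≤ nx, ∀ j < ny, |φ i j - θ i j| ≤ c) :
    ipTM x y nx ny φ φ ≤ 2 * ipTM x y nx ny θ θ + 2 * c ^ 2 := by
  have hw : ∑ i ∈ Ico 1 nx, ∑ j ∈ range ny, hNode x nx i * hMid y j ≤ 1 := by
    simp_rw [← mul_sum, hy.sum_hMid, mul_one]
    exact hx.sum_hNode_interior_le hnx
  calc ipTM x y nx ny φ φ
      ≤ ∑ i ∈ Ico 1 nx, ∑ j ∈ range ny, (2 * (hNode x nx i * hMid y j * θ i j * θ i j)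
          + 2 * c ^ 2 * (hNode x nx i * hMid y j)) := by
        refine sum_le_sum fun i hi => sum_le_sum fun j hj => ?_
        have hi := mem_Ico.1 hi
        have h₁ := hx.hNode_pos (by omega) hi.2.le
        have h₂ := hy.hMid_pos (mem_range.1 hj)
        have h₃ := sq_le_sq' (abs_le.1 (h i hi.2.le j (mem_range.1 hj))).1
          (abs_le.1 (h i hi.2.le j (mem_range.1 hj))).2
        have h₄ : φ i j * φ i j ≤ 2 * (θ i j * θ i j) + 2 * c ^ 2 := by
          nlinarith [sq_nonneg (φ i j - 2 * θ i j)]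
        have h₅ := mul_le_mul_of_nonneg_left h₄ (mul_pos h₁ h₂).le
        linarith
    _ ≤ 2 * ipTM x y nx ny θ θ + 2 * c ^ 2 := by
        have h₁ := mul_le_of_le_one_right (a := 2 * c ^ 2) (by positivity) hw
        simp only [ipTM, mul_sum, sum_add_distrib] at h₁ ⊢
        linarith

lemma displacement_error_le (hmu : 0 < mu) (hlam : 0 < lam) (hx : IsGrid x nx)
    (hy : IsGrid y ny) (hnx : 1 ≤ nx) (hny : 1 ≤ ny) (hHx : ∀ i < nx, hMid x i ≤ H)
    (hHy : ∀ j < ny, hMid y j ≤ H) (hCx : ∀ i < nx, C0 * H ≤ hMid x i)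
    (hCy : ∀ j < ny, C0 * H ≤ hMid y j) (hC0 : 0 < C0) (hH : 0 < H) (hM : 0 ≤ M)
    (hux : HasBoundedDerivs 3 ux M) (huy : HasBoundedDerivs 3 uy M)
    (hbd : ∀ p : ℝ × ℝ, p ∈ Set.Icc ((0 : ℝ), (0 : ℝ)) ((1 : ℝ), (1 : ℝ)) →
      (p.1 = 0 ∨ p.1 = 1 ∨ p.2 = 0 ∨ p.2 = 1) → ux p = 0 ∧ uy p = 0)
    (h11 : ∀ p, s11 p = (lam + 2 * mu) * pdx ux p + lam * pdy uy p)
    (h22 : ∀ p, s22 p = lam * pdx ux p + (lam + 2 * mu) * pdy uy p)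
    (h12 : ∀ p, s12 p = mu * (pdy ux p + pdx uy p))
    (hs11 : HasBoundedDerivs 3 s11 M) (hs22 : HasBoundedDerivs 3 s22 M)
    (hs12 : HasBoundedDerivs 3 s12 M)
    (hW : MACESol nx ny x y lam mu Wx Wx0 Wxn Wy Wy0 Wyn Z11 Z22 Z12
      (fun i j => pdx s11 (x i, midpt y j) + pdy s12 (x i, midpt y j))
      (fun i j => pdx s12 (midpt x i, y j) + pdy s22 (midpt x i, y j))) :
    ipTM x y nx ny (fun i j => Wx i j - ux (x i, midpt y j))
        (fun i j => Wx i j - ux (x i, midpt y j))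
        ≤ (24 / mu ^ 2 + 12) * (truncationConst mu C0 * H ^ 2 * M) ^ 2 ∧
      ipMT x y nx ny (fun i j => Wy i j - uy (midpt x i, y j))
        (fun i j => Wy i j - uy (midpt x i, y j))
        ≤ (24 / mu ^ 2 + 12) * (truncationConst mu C0 * H ^ 2 * M) ^ 2 := by
  obtain ⟨U, V, hU, hV, h⟩ := exists_displacement_superclose hmu hlam hx hy hnx hny hHx hHy hCx
    hCy hC0 hH hM hux huy hbd h11 h22 h12 hs11 hs22 hs12 hW
  rw [ipMT_eq_ipTM_swap] at h ⊢
  have hX := ipTM_le_of_abs_sub_le (φ := fun i j => Wx i j - ux (x i, midpt y j))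
    (θ := fun i j => Wx i j - U i j) hx hy hnx fun i hi j hj => by
      rw [sub_sub_sub_cancel_left]; exact hU i hi j hj
  have hY := ipTM_le_of_abs_sub_le (φ := fun j i => Wy i j - uy (midpt x i, y j))
    (θ := fun j i => Wy i j - V i j) hy hx hny fun j hj i hi => by
      rw [sub_sub_sub_cancel_left]; exact hV i hi j hj
  have hX0 := ipTM_self_nonneg hx hy fun i j => Wx i j - U i j
  have hY0 := ipTM_self_nonneg hy hx fun j i => Wy i j - V i j
  rw [show 24 / mu ^ 2 + 12 = 2 * (12 / mu ^ 2 + 5) + 2 by ring, add_mul, mul_assoc 2]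
  constructor <;> linarith

lemma hMid_le_hmax (x : ℕ → ℝ) {n i : ℕ} (hi : i < n) : hMid x i ≤ hmax x n :=
  le_ciSup (f := fun i : Fin n => hMid x i) (Set.finite_range _).bddAbove ⟨i, hi⟩

end Convergence

/-- Locking-free second-order convergence of the MAC-E displacements: there are
`C, h₀ > 0` depending only on `μ` and the mesh-regularity constant `C₀`
(independent of `h`, `l` and the Lamé constant `λ`) such that, if `max(h,l) ≤ h₀`,
then `‖Wˣ - uˣ‖_{TM} ≤ C(h²+l²)(‖u‖_{3,∞} + ‖σ‖_{3,∞})` and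
`‖Wʸ - uʸ‖_{MT} ≤ C(h²+l²)(‖u‖_{3,∞} + ‖σ‖_{3,∞})`, the exact displacements being
evaluated at the corresponding staggered grid points. -/
theorem mac_locking_free_displacement_convergence
    (mu C0 : ℝ) (hmu : 0 < mu) (hC0 : 0 < C0) :
    ∃ C > (0 : ℝ), ∃ h0 > (0 : ℝ), ∀ lam : ℝ, 0 < lam →
    ∀ (nx ny : ℕ), 2 ≤ nx → 2 ≤ ny → ∀ (x y : ℕ → ℝ),
    IsGrid x nx → IsGrid y ny →
    (∀ i < nx, C0 * max (hmax x nx) (hmax y ny) ≤ hMid x i) →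
    (∀ j < ny, C0 * max (hmax x nx) (hmax y ny) ≤ hMid y j) →
    max (hmax x nx) (hmax y ny) ≤ h0 →
    ∀ ux uy : ℝ × ℝ → ℝ, ContDiff ℝ 3 ux → ContDiff ℝ 3 uy →
    (∀ p : ℝ × ℝ, p ∈ Set.Icc ((0 : ℝ), (0 : ℝ)) ((1 : ℝ), (1 : ℝ)) →
      (p.1 = 0 ∨ p.1 = 1 ∨ p.2 = 0 ∨ p.2 = 1) → ux p = 0 ∧ uy p = 0) →
    ∀ s11 s22 s12 : ℝ × ℝ → ℝ,
    (∀ p, s11 p = (lam + 2 * mu) * pdx ux p + lam * pdy uy p) →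
    (∀ p, s22 p = lam * pdx ux p + (lam + 2 * mu) * pdy uy p) →
    (∀ p, s12 p = mu * (pdy ux p + pdx uy p)) →
    ContDiff ℝ 3 s11 → ContDiff ℝ 3 s22 → ContDiff ℝ 3 s12 →
    ∀ (Wx : ℕ → ℕ → ℝ) (Wx0 Wxn : ℕ → ℝ) (Wy : ℕ → ℕ → ℝ) (Wy0 Wyn : ℕ → ℝ)
      (Z11 Z22 Z12 : ℕ → ℕ → ℝ),
    MACESol nx ny x y lam mu Wx Wx0 Wxn Wy Wy0 Wyn Z11 Z22 Z12
      (fun i j => pdx s11 (x i, midpt y j) + pdy s12 (x i, midpt y j))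
      (fun i j => pdx s12 (midpt x i, y j) + pdy s22 (midpt x i, y j)) →
    Real.sqrt (ipTM x y nx ny
          (fun i j => Wx i j - ux (x i, midpt y j))
          (fun i j => Wx i j - ux (x i, midpt y j)))
      ≤ C * ((hmax x nx) ^ 2 + (hmax y ny) ^ 2)
          * (max (norm3 ux) (norm3 uy)
            + max (norm3 s11) (max (norm3 s22) (norm3 s12))) ∧
    Real.sqrt (ipMT x y nx ny
          (fun i j => Wy i j - uy (midpt x i, y j))
          (fun i j => Wy i j - uy (midpt x i, y j)))
      ≤ C * ((hmax x nx) ^ 2 + (hmax y ny) ^ 2)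
          * (max (norm3 ux) (norm3 uy)
            + max (norm3 s11) (max (norm3 s22) (norm3 s12))) := by
  have hK := truncationConst_pos hmu hC0
  refine ⟨√(24 / mu ^ 2 + 12) * truncationConst mu C0, by positivity, 1, one_pos, ?_⟩
  intro lam hlam nx ny hnx hny x y hx hy hCx hCy _ ux uy hux huy hbd s11 s22 s12 h11 h22 h12
    hs11 hs22 hs12 Wx Wx0 Wxn Wy Wy0 Wyn Z11 Z22 Z12 hW
  have h0 : (0 : ℝ) ∈ Set.Icc (0 : ℝ) 1 := ⟨le_rfl, zero_le_one⟩
  have hnonneg : ∀ {f : ℝ × ℝ → ℝ}, ContDiff ℝ 3 f → 0 ≤ norm3 f := fun hf =>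
    (abs_nonneg _).trans ((hasBoundedDerivs_norm3 hf).abs_le h0 h0)
  have hbound : ∀ {f : ℝ × ℝ → ℝ} {M : ℝ}, ContDiff ℝ 3 f → norm3 f ≤ M →
      HasBoundedDerivs 3 f M := fun hf h => (hasBoundedDerivs_norm3 hf).mono h
  set Mu := max (norm3 ux) (norm3 uy)
  set Ms := max (norm3 s11) (max (norm3 s22) (norm3 s12))
  have hMu0 : 0 ≤ Mu := (hnonneg hux).trans (le_max_left _ _)
  have hMs0 : 0 ≤ Ms := (hnonneg hs11).trans (le_max_left _ _)
  set H := max (hmax x nx) (hmax y ny) with hHdef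
  have hHx : ∀ i < nx, hMid x i ≤ H := fun i hi => (hMid_le_hmax x hi).trans (le_max_left _ _)
  have hHy : ∀ j < ny, hMid y j ≤ H := fun j hj => (hMid_le_hmax y hj).trans (le_max_right _ _)
  have hH : 0 < H := (hx.hMid_pos (by omega)).trans_le (hHx 0 (by omega))
  have hH2 : H ^ 2 ≤ hmax x nx ^ 2 + hmax y ny ^ 2 := by
    rcases max_choice (hmax x nx) (hmax y ny) with h | h <;> rw [hHdef, h] <;>
      simp only [le_add_iff_nonneg_right, le_add_iff_nonneg_left, sq_nonneg]
  obtain ⟨hX, hY⟩ := displacement_error_le hmu hlam hx hy (by omega) (by omega) hHx hHy hCx hCy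
    hC0 hH (add_nonneg hMu0 hMs0)
    (hbound hux ((le_max_left _ _).trans (le_add_of_nonneg_right hMs0)))
    (hbound huy ((le_max_right _ _).trans (le_add_of_nonneg_right hMs0))) hbd h11 h22 h12
    (hbound hs11 ((le_max_left _ _).trans (le_add_of_nonneg_left hMu0)))
    (hbound hs22 (((le_max_left _ _).trans (le_max_right _ _)).trans
      (le_add_of_nonneg_left hMu0)))
    (hbound hs12 (((le_max_right _ _).trans (le_max_right _ _)).trans
      (le_add_of_nonneg_left hMu0))) hW
  have hfinal : √((24 / mu ^ 2 + 12) * (truncationConst mu C0 * H ^ 2 * (Mu + Ms)) ^ 2)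
      ≤ √(24 / mu ^ 2 + 12) * truncationConst mu C0 * (hmax x nx ^ 2 + hmax y ny ^ 2)
        * (Mu + Ms) := by
    rw [Real.sqrt_mul (by positivity), Real.sqrt_sq (by positivity), ← mul_assoc, ← mul_assoc]
    gcongr
  exact ⟨(Real.sqrt_le_sqrt hX).trans hfinal, (Real.sqrt_le_sqrt hY).trans hfinal⟩
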